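/- There exists a continuous bijection f : [0,1] → B_{α-1} with f(0) = -1 and f(1) = -(a-1)·α - α⁻¹; in particular (since [0,1] is compact and B_{α-1} is Hausdorff) B_{α-1} is homeomorphic to the interval [0,1]. -/

import Mathlib

open Complex Filter Topology

noncomputable section

/-- The word `w₁w₂w₃w₄` is lexicographically smaller than the word `(a-1)(a-1)01`. -/
def WordLt (a : ℤ) (w₁ w₂ w₃ w₄ : ℤ) : Prop :=
  w₁ < a - 1 ∨ (w₁ = a - 1 ∧ (w₂ < a - 1 ∨ (w₂ = a - 1 ∧ (w₃ < 0 ∨ (w₃ = 0 ∧ w₄ < 1)))))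

/-- A sequence of integers `(c i)_{i ≥ k}` with `0 ≤ c i ≤ a-1` is admissible if for every
`i ≥ k+3` the word `c i, c (i-1), c (i-2), c (i-3)` is lexicographically smaller
than `(a-1)(a-1)01`. (Values of `c` below index `k` are irrelevant.) -/
def Admissible (a k : ℤ) (c : ℤ → ℤ) : Prop :=
  (∀ i, k ≤ i → 0 ≤ c i ∧ c i ≤ a - 1) ∧
  (∀ i, k + 3 ≤ i → WordLt a (c i) (c (i - 1)) (c (i - 2)) (c (i - 3)))

/-- The Rauzy fractal `R_a = { Σ_{i=2}^∞ c_i α^i : (c_i)_{i≥2} admissible }`. -/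
def Rauzy (a : ℤ) (α : ℂ) : Set ℂ :=
  {z | ∃ c : ℤ → ℤ, Admissible a 2 c ∧
    z = ∑' n : ℕ, (c ((n : ℤ) + 2) : ℂ) * α ^ (n + 2)}

/-- `B_v = R_a ∩ (R_a + v)`. -/
def BSet (a : ℤ) (α : ℂ) (v : ℂ) : Set ℂ :=
  Rauzy a α ∩ ((· + v) '' Rauzy a α)

/-- `B'_{α-1}`: points of `B_{α-1}` admitting an admissible expansion
`z = α - 1 + Σ_{i=3}^∞ c_i α^i` with `c 3 ≠ a-1`. -/
def Bprime (a : ℤ) (α : ℂ) : Set ℂ :=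
  {z | z ∈ BSet a α (α - 1) ∧ ∃ c : ℤ → ℤ, Admissible a 3 c ∧ c 3 ≠ a - 1 ∧
    z = α - 1 + ∑' n : ℕ, (c ((n : ℤ) + 3) : ℂ) * α ^ (n + 3)}

/-- `g_{2k+1}(z) = -1 - k α³ + α³ z`. -/
def gOdd (α : ℂ) (k : ℤ) (z : ℂ) : ℂ := -1 - (k : ℂ) * α ^ 3 + α ^ 3 * z

/-- `g_{2k}(z) = α - 1 + (a-1-k) α³ + α² z`. -/
def gEven (a : ℤ) (α : ℂ) (k : ℤ) (z : ℂ) : ℂ :=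
  α - 1 + ((a : ℂ) - 1 - (k : ℂ)) * α ^ 3 + α ^ 2 * z


/-- index of the piece containing the parameter `t` -/
def arcIdx (N : ℕ) (t : ℝ) : ℕ := min ⌊(N : ℝ) * t⌋₊ (N - 1)

/-- lower end of the parameter interval of piece `j` -/
def arcLo (N : ℕ) (full : ℕ → Bool) (j : ℕ) : ℝ := if full j then 0 else 2 / N

/-- renormalisation map on piece `j` -/
def arcPhi (N : ℕ) (full : ℕ → Bool) (j : ℕ) (t : ℝ) : ℝ :=
  arcLo N full j + (1 - arcLo N full j) * (j + 1 - N * t)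

/-- global renormalisation -/
def arcStep (N : ℕ) (full : ℕ → Bool) (t : ℝ) : ℝ := arcPhi N full (arcIdx N t) t

/-- the parametrisation -/
def arcFun (N : ℕ) (full : ℕ → Bool) (b r : ℕ → ℂ) (t : ℝ) : ℂ :=
  ∑' n : ℕ, (∏ i ∈ Finset.range n, r (arcIdx N ((arcStep N full)^[i] t))) *
    b (arcIdx N ((arcStep N full)^[n] t))

lemma arcIdx_lt {N : ℕ} (hN : 5 ≤ N) (t : ℝ) : arcIdx N t < N := by
  unfold arcIdx; omega

section
variable {N : ℕ} (hN : 5 ≤ N) {full : ℕ → Bool} {b r : ℕ → ℂ} {q : ℝ}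
  (hq : q < 1 / 2) (hr : ∀ j, ‖r j‖ ≤ q)

include hN hq hr

lemma arc_term_bound (t : ℝ) (n : ℕ) :
    ‖(∏ i ∈ Finset.range n, r (arcIdx N ((arcStep N full)^[i] t))) *
    b (arcIdx N ((arcStep N full)^[n] t))‖ ≤ q ^ n * ∑ j ∈ Finset.range N, ‖b j‖ := by
  have hq0 : 0 ≤ q := (norm_nonneg _).trans (hr 0)
  rw [norm_mul, norm_prod]
  gcongr
  · calc _ ≤ ∏ i ∈ Finset.range n, q := Finset.prod_le_prod (fun _ _ => norm_nonneg _) (fun _ _ => hr _)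
      _ = q ^ n := by simp
  · exact Finset.single_le_sum (f := fun j => ‖b j‖) (fun _ _ => norm_nonneg _)
      (Finset.mem_range.2 (arcIdx_lt hN _))

lemma arc_geo : Summable (fun n : ℕ => q ^ n * ∑ j ∈ Finset.range N, ‖b j‖) := by
  have hq0 : 0 ≤ q := (norm_nonneg _).trans (hr 0)
  exact (summable_geometric_of_lt_one hq0 (by linarith)).mul_right _

lemma arc_summable (t : ℝ) : Summable (fun n : ℕ =>
    (∏ i ∈ Finset.range n, r (arcIdx N ((arcStep N full)^[i] t))) *
    b (arcIdx N ((arcStep N full)^[n] t))) :=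
  Summable.of_norm_bounded (arc_geo hN hq hr) (arc_term_bound hN hq hr t)

lemma arc_bound : ∃ D : ℝ, 0 ≤ D ∧ ∀ t, ‖arcFun N full b r t‖ ≤ D := by
  have hq0 : 0 ≤ q := (norm_nonneg _).trans (hr 0)
  refine ⟨∑' n : ℕ, q ^ n * ∑ j ∈ Finset.range N, ‖b j‖, tsum_nonneg fun n => by positivity, fun t => ?_⟩
  exact tsum_of_norm_bounded (arc_geo hN hq hr).hasSum (arc_term_bound hN hq hr t)

lemma arc_eq (t : ℝ) : arcFun N full b r t =
    b (arcIdx N t) + r (arcIdx N t) * arcFun N full b r (arcStep N full t) := by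
  unfold arcFun
  rw [(arc_summable hN hq hr t).tsum_eq_zero_add, ← tsum_mul_left]
  congr 1
  · simp
  · congr 1; ext n
    rw [Finset.prod_range_succ']
    simp only [Function.iterate_succ, Function.comp, Function.iterate_zero, id]
    ring

omit hq hr in
lemma arcLo_bd (j : ℕ) : 0 ≤ arcLo N full j ∧ arcLo N full j ≤ 2 / 5 := by
  have : (5 : ℝ) ≤ N := by exact_mod_cast hN
  unfold arcLo; split_ifs
  · norm_num
  · constructor
    · positivity
    · rw [div_le_div_iff₀ (by linarith) (by norm_num)]; linarith

omit hq hr in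
lemma arcIdx_spec {t : ℝ} (h0 : 0 ≤ t) (h1 : t ≤ 1) :
    (arcIdx N t : ℝ) ≤ N * t ∧ N * t ≤ arcIdx N t + 1 := by
  have hN' : (5 : ℝ) ≤ N := by exact_mod_cast hN
  have hnn : 0 ≤ (N : ℝ) * t := by positivity
  constructor
  · calc (arcIdx N t : ℝ) ≤ ⌊(N : ℝ) * t⌋₊ := by unfold arcIdx; exact_mod_cast min_le_left _ _
      _ ≤ _ := Nat.floor_le hnn
  · unfold arcIdx
    rcases le_total ⌊(N : ℝ) * t⌋₊ (N - 1) with h | h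
    · rw [min_eq_left h]; exact (Nat.lt_floor_add_one _).le
    · rw [min_eq_right h]
      have : ((N - 1 : ℕ) : ℝ) = N - 1 := by push_cast [Nat.cast_sub (show 1 ≤ N by omega)]; ring
      rw [this]; nlinarith

omit hq hr in
lemma arcIdx_eq {t : ℝ} {j : ℕ} (hj : j < N) (h0 : (j : ℝ) ≤ N * t) (h1 : N * t < j + 1) :
    arcIdx N t = j := by
  unfold arcIdx
  have : ⌊(N : ℝ) * t⌋₊ = j := by
    rw [Nat.floor_eq_iff (le_trans (by positivity) h0)]; exact ⟨h0, h1⟩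
  rw [this]; omega

variable {p pp qq : ℂ} (hfull : full (N - 1) = true)
  (e0 : b 0 + r 0 * qq = p) (eN : b (N - 1) + r (N - 1) * p = qq) (e2 : b 2 + r 2 * qq = pp)
include hfull e0 eN 

omit hq hr e0 eN in
lemma arcIdx_one : arcIdx N 1 = N - 1 := by
  unfold arcIdx; simp

lemma arc_ends : arcFun N full b r 0 = p ∧ arcFun N full b r 1 = qq := by
  have hq0 : 0 ≤ q := (norm_nonneg _).trans (hr 0)
  have i0 : arcIdx N 0 = 0 := by unfold arcIdx; simp
  have i1 : arcIdx N 1 = N - 1 := by unfold arcIdx; simp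
  have c : ((N - 1 : ℕ) : ℝ) = N - 1 := by push_cast [Nat.cast_sub (show 1 ≤ N by omega)]; ring
  have f0 := arc_eq (full := full) (b := b) hN hq hr 0
  have f1 := arc_eq (full := full) (b := b) hN hq hr 1
  have s0 : arcStep N full 0 = 1 := by unfold arcStep arcPhi; rw [i0]; simp
  have s1 : arcStep N full 1 = 0 := by
    unfold arcStep arcPhi; rw [i1, c]; unfold arcLo; rw [hfull]; simp
  rw [i0, s0] at f0
  rw [i1, s1] at f1
  set x := arcFun N full b r 0
  set y := arcFun N full b r 1
  have : x - p = r 0 * r (N - 1) * (x - p) := by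
    linear_combination f0 + e0 + r 0 * f1 + r 0 * eN
  have h3 : ‖x - p‖ ≤ q * q * ‖x - p‖ := by
    conv_lhs => rw [this]
    rw [norm_mul, norm_mul]
    gcongr <;> exact hr _
  have hqq : q * q ≤ 1 / 2 := by nlinarith
  have h4 : ‖x - p‖ = 0 := by nlinarith [norm_nonneg (x - p)]
  have h5 : x = p := by rwa [norm_eq_zero, sub_eq_zero] at h4
  exact ⟨h5, by rw [f1, h5, eN]⟩

include e2 in
lemma arc_two : arcFun N full b r (2 / N) = pp := by
  have hN' : (5 : ℝ) ≤ N := by exact_mod_cast hN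
  have hh : (N : ℝ) * (2 / N) = 2 := by field_simp
  have i2 : arcIdx N (2 / N) = 2 := arcIdx_eq hN (by omega) (by rw [hh]; norm_num) (by rw [hh]; norm_num)
  have s2 : arcStep N full (2 / N) = 1 := by unfold arcStep arcPhi; rw [i2, hh]; push_cast; ring
  rw [arc_eq hN hq hr, i2, s2, (arc_ends hN hq hr hfull e0 eN).2, e2]

variable (hJ : ∀ j, j + 1 < N → b (j + 1) + r (j + 1) * qq = b j + r j * (if full j then p else pp))
include e2 hJ

lemma arc_piece {t : ℝ} {j : ℕ} (hj : j < N) (h0 : (j : ℝ) ≤ N * t) (h1 : N * t ≤ j + 1) :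
    arcFun N full b r t = b j + r j * arcFun N full b r (arcPhi N full j t) := by
  rcases lt_or_eq_of_le h1 with h | h
  · have i := arcIdx_eq hN hj h0 h
    rw [arc_eq hN hq hr t, i, arcStep, i]
  · have hp : arcPhi N full j t = arcLo N full j := by unfold arcPhi; rw [h]; ring
    by_cases hj' : j + 1 < N
    · have i := arcIdx_eq (t := t) hN hj' (by rw [h]; push_cast; rfl) (by rw [h]; push_cast; linarith)
      have : arcStep N full t = 1 := by unfold arcStep arcPhi; rw [i, h]; push_cast; ring
      rw [arc_eq hN hq hr t, i, this, (arc_ends hN hq hr hfull e0 eN).2, hJ j hj', hp]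
      unfold arcLo
      split_ifs
      · rw [(arc_ends hN hq hr hfull e0 eN).1]
      · rw [arc_two hN hq hr hfull e0 eN e2]
    · have : j = N - 1 := by omega
      have c : ((N - 1 : ℕ) : ℝ) = N - 1 := by push_cast [Nat.cast_sub (show 1 ≤ N by omega)]; ring
      have hN' : (5 : ℝ) ≤ N := by exact_mod_cast hN
      have ht : t = 1 := by
        rw [this, c] at h
        have : (N : ℝ) * (t - 1) = 0 := by linarith
        rcases mul_eq_zero.1 this with h | h <;> linarith
      rw [arc_eq hN hq hr t, arcStep, ht, arcIdx_one hN hfull, this]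

omit hq hr e0 eN hfull e2 hJ in
lemma arcPhi_mem {t : ℝ} {j : ℕ} (h0 : (j : ℝ) ≤ N * t) (h1 : N * t ≤ j + 1) :
    arcLo N full j ≤ arcPhi N full j t ∧ arcPhi N full j t ≤ 1 := by
  obtain ⟨l0, l1⟩ := arcLo_bd (full := full) hN j
  unfold arcPhi
  constructor <;> nlinarith

omit hq hr e0 eN hfull e2 hJ in
lemma arcPhi_sub (t t' : ℝ) (j : ℕ) :
    |arcPhi N full j t - arcPhi N full j t'| = (1 - arcLo N full j) * N * |t - t'| := by
  obtain ⟨l0, l1⟩ := arcLo_bd (full := full) hN j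
  have : arcPhi N full j t - arcPhi N full j t' = -((1 - arcLo N full j) * N * (t - t')) := by
    unfold arcPhi; ring
  rw [this, abs_neg, abs_mul, abs_of_nonneg]
  have : 0 ≤ 1 - arcLo N full j := by linarith
  positivity

lemma arc_modulus {D : ℝ} (hD : ∀ t, ‖arcFun N full b r t‖ ≤ D) (n : ℕ) :
    ∀ t t' : ℝ, 0 ≤ t → t ≤ t' → t' ≤ 1 → t' - t ≤ (1 / N : ℝ) ^ n →
      ‖arcFun N full b r t - arcFun N full b r t'‖ ≤ 2 * D * (2 * q) ^ n := by
  have hq0 : 0 ≤ q := (norm_nonneg _).trans (hr 0)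
  have hN' : (5 : ℝ) ≤ N := by exact_mod_cast hN
  have hD0 : 0 ≤ D := (norm_nonneg _).trans (hD 0)
  induction n with
  | zero =>
    intro t t' _ _ _ _
    simp only [pow_zero, mul_one]
    calc _ ≤ _ := norm_sub_le _ _
      _ ≤ _ := by linarith [hD t, hD t']
  | succ n ih =>
    -- same piece estimate
    have key : ∀ t t' : ℝ, ∀ j : ℕ, j < N → t ≤ t' → (j : ℝ) ≤ N * t → N * t' ≤ j + 1 →
        t' - t ≤ (1 / N : ℝ) ^ (n + 1) →
        ‖arcFun N full b r t - arcFun N full b r t'‖ ≤ q * (2 * D * (2 * q) ^ n) := by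
      intro t t' j hj htt h0 h1 hd
      have h0' : (j : ℝ) ≤ N * t' := by nlinarith
      have h1' : N * t ≤ (j : ℝ) + 1 := by nlinarith
      rw [arc_piece hN hq hr hfull e0 eN e2 hJ hj h0 h1',
        arc_piece hN hq hr hfull e0 eN e2 hJ hj h0' h1]
      have l := arcLo_bd (full := full) hN j
      have m := arcPhi_mem (full := full) hN h0 h1'
      have m' := arcPhi_mem (full := full) hN h0' h1
      have e : arcPhi N full j t - arcPhi N full j t' = (1 - arcLo N full j) * N * (t' - t) := by
        unfold arcPhi; ring
      have hb : (1 - arcLo N full j) * N * (t' - t) ≤ (1 / N : ℝ) ^ n := by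
        have h3 : (N : ℝ) * (t' - t) ≤ (1 / N : ℝ) ^ n := by
          calc (N : ℝ) * (t' - t) ≤ N * (1 / N : ℝ) ^ (n + 1) := by gcongr
            _ = _ := by rw [pow_succ]; field_simp
        have h4 : 0 ≤ (N : ℝ) * (t' - t) := mul_nonneg (by linarith) (by linarith)
        nlinarith [l.1]
      have hb0 : 0 ≤ (1 - arcLo N full j) * N * (t' - t) :=
        mul_nonneg (mul_nonneg (by linarith) (by linarith)) (by linarith)
      have := ih (arcPhi N full j t') (arcPhi N full j t) (by linarith) (by linarith) (by linarith)
        (by linarith)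
      calc _ = ‖r j * (arcFun N full b r (arcPhi N full j t') - arcFun N full b r (arcPhi N full j t))‖ := by
            rw [← norm_neg]; congr 1; ring
        _ ≤ _ := by rw [norm_mul]; gcongr; exact hr j
    intro t t' h0 htt h1 hd
    have hpos : 0 ≤ q * (2 * D * (2 * q) ^ n) := by positivity
    have hfin : 2 * D * (2 * q) ^ (n + 1) = q * (2 * D * (2 * q) ^ n) + q * (2 * D * (2 * q) ^ n) := by
      rw [pow_succ]; ring
    rw [hfin]
    set j := arcIdx N t with hjdef
    have hj : j < N := arcIdx_lt hN t
    obtain ⟨s0, s1⟩ := arcIdx_spec hN h0 (htt.trans h1)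
    by_cases hc : N * t' ≤ (j : ℝ) + 1
    · exact (key t t' j hj htt s0 hc hd).trans (by linarith)
    · push Not at hc
      have hjN : j + 1 < N := by
        by_contra hcon
        have : (N : ℝ) ≤ j + 1 := by exact_mod_cast (by omega : N ≤ j + 1)
        nlinarith
      have hN1 : (N : ℝ) * (t' - t) ≤ 1 := by
        calc (N : ℝ) * (t' - t) ≤ N * (1 / N : ℝ) ^ (n + 1) := by gcongr
          _ = (1 / N : ℝ) ^ n := by rw [pow_succ]; field_simp
          _ ≤ 1 := pow_le_one₀ (by positivity) (by rw [div_le_one] <;> linarith)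
      have hx : (N : ℝ) * (((j : ℝ) + 1) / N) = j + 1 := by field_simp
      set x : ℝ := ((j : ℝ) + 1) / N
      have htx : t ≤ x := by
        by_contra hcon; push Not at hcon; nlinarith
      have hxt : x ≤ t' := by
        by_contra hcon; push Not at hcon; nlinarith
      have k1 := key t x j hj htx s0 hx.le (by linarith)
      have k2 := key x t' (j + 1) hjN hxt (by push_cast; linarith) (by push_cast; nlinarith) (by linarith)
      calc _ = ‖(arcFun N full b r t - arcFun N full b r x) + (arcFun N full b r x - arcFun N full b r t')‖ := by
            congr 1; ring
        _ ≤ _ := (norm_add_le _ _).trans (by linarith)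

lemma arc_cont : ContinuousOn (arcFun N full b r) (Set.Icc 0 1) := by
  have hq0 : 0 ≤ q := (norm_nonneg _).trans (hr 0)
  have hN' : (5 : ℝ) ≤ N := by exact_mod_cast hN
  obtain ⟨D, hD0, hD⟩ := arc_bound (full := full) (b := b) hN hq hr
  rw [Metric.continuousOn_iff]
  intro x hx ε hε
  have hlim : Tendsto (fun n : ℕ => 2 * D * (2 * q) ^ n) atTop (𝓝 (2 * D * 0)) :=
    (tendsto_pow_atTop_nhds_zero_of_lt_one (by linarith) (by linarith)).const_mul _
  rw [mul_zero] at hlim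
  obtain ⟨n, hn⟩ := (hlim.eventually (gt_mem_nhds hε)).exists
  refine ⟨(1 / N : ℝ) ^ n, by positivity, fun y hy hd => ?_⟩
  rw [Real.dist_eq, abs_lt] at hd
  rw [dist_eq_norm]
  rcases le_total x y with h | h
  · rw [← norm_neg, neg_sub]
    exact (arc_modulus hN hq hr hfull e0 eN e2 hJ hD n x y hx.1 h hy.2 (by linarith)).trans_lt hn
  · exact (arc_modulus hN hq hr hfull e0 eN e2 hJ hD n y x hy.1 h hx.2 (by linarith)).trans_lt hn

variable {W W' : Set ℂ} 

lemma arc_inj (hr0 : ∀ j, r j ≠ 0)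
    (hmap : ∀ t, 0 ≤ t → t ≤ 1 → arcFun N full b r t ∈ W)
    (hmap' : ∀ t, 2 / (N : ℝ) ≤ t → t ≤ 1 → arcFun N full b r t ∈ W')
    (hS : ∀ i j, i < j → j < N → ∀ w ∈ (if full i then W else W'), ∀ w' ∈ (if full j then W else W'),
      b i + r i * w = b j + r j * w' → j = i + 1 ∧ b j + r j * w' = b j + r j * qq) :
    Set.InjOn (arcFun N full b r) (Set.Icc 0 1) := by
  have hN' : (5 : ℝ) ≤ N := by exact_mod_cast hN
  -- same piece
  have same : ∀ t t' : ℝ, ∀ j : ℕ, j < N → t ≤ t' → (j : ℝ) ≤ N * t → N * t' ≤ j + 1 →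
      arcFun N full b r t = arcFun N full b r t' →
      ∃ s s' : ℝ, 0 ≤ s ∧ s ≤ s' ∧ s' ≤ 1 ∧ arcFun N full b r s = arcFun N full b r s' ∧
        3 * (t' - t) ≤ s' - s := by
    intro t t' j hj htt h0 h1 he
    have h0' : (j : ℝ) ≤ N * t' := by nlinarith
    have h1' : N * t ≤ (j : ℝ) + 1 := by nlinarith
    rw [arc_piece hN hq hr hfull e0 eN e2 hJ hj h0 h1',
        arc_piece hN hq hr hfull e0 eN e2 hJ hj h0' h1] at he
    have he' := mul_left_cancel₀ (hr0 j) (add_left_cancel he)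
    have l := arcLo_bd (full := full) hN j
    have m := arcPhi_mem (full := full) hN h0 h1'
    have m' := arcPhi_mem (full := full) hN h0' h1
    have e : arcPhi N full j t - arcPhi N full j t' = (1 - arcLo N full j) * N * (t' - t) := by
      unfold arcPhi; ring
    have hge : 3 * (t' - t) ≤ (1 - arcLo N full j) * N * (t' - t) := by
      apply mul_le_mul_of_nonneg_right _ (by linarith)
      nlinarith
    exact ⟨_, _, by linarith, by linarith, m.2, he'.symm, by linarith⟩
  have grow : ∀ t t' : ℝ, 0 ≤ t → t ≤ t' → t' ≤ 1 → arcFun N full b r t = arcFun N full b r t' →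
      ∃ s s' : ℝ, 0 ≤ s ∧ s ≤ s' ∧ s' ≤ 1 ∧ arcFun N full b r s = arcFun N full b r s' ∧
        (3 / 2) * (t' - t) ≤ s' - s := by
    intro t t' h0 htt h1 he
    obtain ⟨s0, s1⟩ := arcIdx_spec hN h0 (htt.trans h1)
    obtain ⟨s0', s1'⟩ := arcIdx_spec hN (h0.trans htt) h1
    have hi := arcIdx_lt hN t
    have hj := arcIdx_lt hN t'
    set i := arcIdx N t
    set j := arcIdx N t'
    by_cases hij : i < j
    · have mem : ∀ k : ℕ, k < N → ∀ t : ℝ, (k : ℝ) ≤ N * t → N * t ≤ k + 1 →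
          arcFun N full b r (arcPhi N full k t) ∈ (if full k then W else W') := by
        intro k hk t h0 h1
        have m := arcPhi_mem (full := full) hN h0 h1
        unfold arcLo at m
        split_ifs at m ⊢
        · exact hmap _ m.1 m.2
        · exact hmap' _ m.1 m.2
      have ht := arc_piece hN hq hr hfull e0 eN e2 hJ hi s0 s1
      have ht' := arc_piece hN hq hr hfull e0 eN e2 hJ hj s0' s1'
      obtain ⟨hji, hv⟩ := hS i j hij hj _ (mem i hi t s0 s1) _ (mem j hj t' s0' s1')
        (by rw [← ht, ← ht', he])
      rw [← ht'] at hv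
      have hx : (N : ℝ) * ((j : ℝ) / N) = j := by field_simp
      set x : ℝ := (j : ℝ) / N
      have hji' : (j : ℝ) = i + 1 := by rw [hji]; push_cast; ring
      have hfx : arcFun N full b r x = b j + r j * qq := by
        rw [arc_piece hN hq hr hfull e0 eN e2 hJ hj hx.ge (by linarith)]
        have : arcPhi N full j x = 1 := by unfold arcPhi; rw [hx]; ring
        rw [this, (arc_ends hN hq hr hfull e0 eN).2]
      have htx : t ≤ x := by
        by_contra hcon; push Not at hcon; nlinarith
      have hxt : x ≤ t' := by
        by_contra hcon; push Not at hcon; nlinarith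
      rcases le_total (x - t) (t' - x) with h | h
      · obtain ⟨s, s', a1, a2, a3, a4, a5⟩ := same x t' j hj hxt hx.ge s1' (by rw [hfx, hv])
        exact ⟨s, s', a1, a2, a3, a4, by linarith⟩
      · obtain ⟨s, s', a1, a2, a3, a4, a5⟩ := same t x i hi htx s0 (by linarith) (by rw [hfx, he, hv])
        exact ⟨s, s', a1, a2, a3, a4, by linarith⟩
    · have : (j : ℝ) ≤ i := by exact_mod_cast (by omega : j ≤ i)
      obtain ⟨s, s', a1, a2, a3, a4, a5⟩ := same t t' i hi htt s0 (by linarith) he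
      exact ⟨s, s', a1, a2, a3, a4, by linarith⟩
  have main : ∀ t t' : ℝ, 0 ≤ t → t ≤ t' → t' ≤ 1 → arcFun N full b r t = arcFun N full b r t' →
      t' - t ≤ 0 := by
    intro t t' h0 htt h1 he
    have it : ∀ n : ℕ, ∃ s s' : ℝ, 0 ≤ s ∧ s ≤ s' ∧ s' ≤ 1 ∧ arcFun N full b r s = arcFun N full b r s' ∧
        (3 / 2) ^ n * (t' - t) ≤ s' - s := by
      intro n
      induction n with
      | zero => exact ⟨t, t', h0, htt, h1, he, by simp⟩
      | succ n ih =>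
        obtain ⟨s, s', a1, a2, a3, a4, a5⟩ := ih
        obtain ⟨u, u', b1, b2, b3, b4, b5⟩ := grow s s' a1 a2 a3 a4
        exact ⟨u, u', b1, b2, b3, b4, by rw [pow_succ]; linarith⟩
    by_contra hcon
    push Not at hcon
    obtain ⟨n, hn⟩ := pow_unbounded_of_one_lt (1 / (t' - t)) (by norm_num : (1 : ℝ) < 3 / 2)
    obtain ⟨s, s', a1, a2, a3, a4, a5⟩ := it n
    rw [div_lt_iff₀ hcon] at hn
    linarith
  intro t ht t' ht' he
  rcases le_total t t' with h | h
  · have := main t t' ht.1 h ht'.2 he; linarith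
  · have := main t' t ht'.1 h ht.2 he.symm; linarith

lemma arc_into (hW : IsClosed W) (hW' : IsClosed W') (hne : W'.Nonempty) (hsub : W' ⊆ W)
    (hC : ∀ j, j < N → ∀ w ∈ (if full j then W else W'), b j + r j * w ∈ W)
    (hC' : ∀ j, j < N → 2 ≤ j → ∀ w ∈ (if full j then W else W'), b j + r j * w ∈ W') :
    (∀ t, 0 ≤ t → t ≤ 1 → arcFun N full b r t ∈ W) ∧
    (∀ t, 2 / (N : ℝ) ≤ t → t ≤ 1 → arcFun N full b r t ∈ W') := by
  have hq0 : 0 ≤ q := (norm_nonneg _).trans (hr 0)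
  have hN' : (5 : ℝ) ≤ N := by exact_mod_cast hN
  obtain ⟨D, hD0, hD⟩ := arc_bound (full := full) (b := b) hN hq hr
  obtain ⟨w0, hw0⟩ := hne
  have main : ∀ n : ℕ, (∀ t, 0 ≤ t → t ≤ 1 → ∃ w ∈ W, ‖arcFun N full b r t - w‖ ≤ q ^ n * (D + ‖w0‖)) ∧
      (∀ t, 2 / (N : ℝ) ≤ t → t ≤ 1 → ∃ w ∈ W', ‖arcFun N full b r t - w‖ ≤ q ^ n * (D + ‖w0‖)) := by
    intro n
    induction n with
    | zero =>
      have : ∀ t, ‖arcFun N full b r t - w0‖ ≤ q ^ 0 * (D + ‖w0‖) := fun t => by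
        rw [pow_zero, one_mul]
        exact (norm_sub_le _ _).trans (by linarith [hD t])
      exact ⟨fun t _ _ => ⟨w0, hsub hw0, this t⟩, fun t _ _ => ⟨w0, hw0, this t⟩⟩
    | succ n ih =>
      have step : ∀ t, 0 ≤ t → t ≤ 1 → ∃ w ∈ (if full (arcIdx N t) then W else W'),
          ‖arcFun N full b r t - (b (arcIdx N t) + r (arcIdx N t) * w)‖ ≤ q ^ (n + 1) * (D + ‖w0‖) := by
        intro t h0 h1
        obtain ⟨s0, s1⟩ := arcIdx_spec hN h0 h1
        have hj := arcIdx_lt hN t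
        set j := arcIdx N t
        have m := arcPhi_mem (full := full) hN s0 s1
        have : ∃ w ∈ (if full j then W else W'),
            ‖arcFun N full b r (arcPhi N full j t) - w‖ ≤ q ^ n * (D + ‖w0‖) := by
          unfold arcLo at m
          split_ifs at m ⊢
          · exact ih.1 _ m.1 m.2
          · exact ih.2 _ m.1 m.2
        obtain ⟨w, hw, hle⟩ := this
        refine ⟨w, hw, ?_⟩
        rw [arc_piece hN hq hr hfull e0 eN e2 hJ hj s0 s1]
        calc _ = ‖r j * (arcFun N full b r (arcPhi N full j t) - w)‖ := by congr 1; ring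
          _ ≤ q * (q ^ n * (D + ‖w0‖)) := by rw [norm_mul]; gcongr; exact hr j
          _ = _ := by rw [pow_succ]; ring
      constructor
      · intro t h0 h1
        obtain ⟨w, hw, hle⟩ := step t h0 h1
        exact ⟨_, hC _ (arcIdx_lt hN t) w hw, hle⟩
      · intro t h0 h1
        have h00 : 0 ≤ t := le_trans (by positivity) h0
        obtain ⟨w, hw, hle⟩ := step t h00 h1
        refine ⟨_, hC' _ (arcIdx_lt hN t) ?_ w hw, hle⟩
        unfold arcIdx
        rw [le_min_iff]
        refine ⟨Nat.le_floor ?_, by omega⟩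
        rw [div_le_iff₀ (by linarith)] at h0
        push_cast; linarith
  have lim : Tendsto (fun n : ℕ => q ^ n * (D + ‖w0‖)) atTop (𝓝 0) := by
    simpa using (tendsto_pow_atTop_nhds_zero_of_lt_one hq0 (by linarith)).mul_const (D + ‖w0‖)
  constructor
  · intro t h0 h1
    rw [← hW.closure_eq, Metric.mem_closure_iff]
    intro ε hε
    obtain ⟨n, hn⟩ := (lim.eventually (gt_mem_nhds hε)).exists
    obtain ⟨w, hw, hle⟩ := (main n).1 t h0 h1
    exact ⟨w, hw, by rw [dist_eq_norm]; linarith⟩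
  · intro t h0 h1
    rw [← hW'.closure_eq, Metric.mem_closure_iff]
    intro ε hε
    obtain ⟨n, hn⟩ := (lim.eventually (gt_mem_nhds hε)).exists
    obtain ⟨w, hw, hle⟩ := (main n).2 t h0 h1
    exact ⟨w, hw, by rw [dist_eq_norm]; linarith⟩

lemma arc_surj (hWb : Bornology.IsBounded W) (hsub : W' ⊆ W)
    (hE : ∀ z ∈ W, ∃ j, j < N ∧ ∃ w ∈ (if full j then W else W'), z = b j + r j * w)
    (hE' : ∀ z ∈ W', ∃ j, j < N ∧ 2 ≤ j ∧ ∃ w ∈ (if full j then W else W'), z = b j + r j * w) :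
    ∀ z ∈ W, z ∈ arcFun N full b r '' (Set.Icc 0 1) := by
  have hq0 : 0 ≤ q := (norm_nonneg _).trans (hr 0)
  have hN' : (5 : ℝ) ≤ N := by exact_mod_cast hN
  obtain ⟨D, hD0, hD⟩ := arc_bound (full := full) (b := b) hN hq hr
  obtain ⟨M, hM⟩ := hWb.exists_norm_le
  have main : ∀ n : ℕ, (∀ z ∈ W, ∃ t, 0 ≤ t ∧ t ≤ 1 ∧ ‖arcFun N full b r t - z‖ ≤ q ^ n * (D + M)) ∧
      (∀ z ∈ W', ∃ t, 2 / (N : ℝ) ≤ t ∧ t ≤ 1 ∧ ‖arcFun N full b r t - z‖ ≤ q ^ n * (D + M)) := by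
    intro n
    induction n with
    | zero =>
      have h2 : ∀ z ∈ W, ‖arcFun N full b r 1 - z‖ ≤ q ^ 0 * (D + M) := fun z hz => by
        rw [pow_zero, one_mul]
        exact (norm_sub_le _ _).trans (by linarith [hD 1, hM z hz])
      exact ⟨fun z hz => ⟨1, by norm_num, le_rfl, h2 z hz⟩, fun z hz => ⟨1, by
        rw [div_le_one] <;> linarith, le_rfl, h2 z (hsub hz)⟩⟩
    | succ n ih =>
      have step : ∀ j, j < N → ∀ w ∈ (if full j then W else W'), ∃ t, (j : ℝ) ≤ N * t ∧ N * t ≤ j + 1 ∧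
          ‖arcFun N full b r t - (b j + r j * w)‖ ≤ q ^ (n + 1) * (D + M) := by
        intro j hj w hw
        have l := arcLo_bd (full := full) hN j
        have : ∃ s, arcLo N full j ≤ s ∧ s ≤ 1 ∧ ‖arcFun N full b r s - w‖ ≤ q ^ n * (D + M) := by
          unfold arcLo
          split_ifs at hw ⊢
          · exact ih.1 w hw
          · exact ih.2 w hw
        obtain ⟨s, hs0, hs1, hle⟩ := this
        have hl : 0 < 1 - arcLo N full j := by linarith
        set x := (s - arcLo N full j) / (1 - arcLo N full j) with hx
        have hx0 : 0 ≤ x := div_nonneg (by linarith) hl.le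
        have hx1 : x ≤ 1 := by rw [hx, div_le_one hl]; linarith
        have ht : (N : ℝ) * ((j + 1 - x) / N) = j + 1 - x := by field_simp
        have a1 : (j : ℝ) ≤ N * ((j + 1 - x) / N) := by rw [ht]; linarith
        have a2 : (N : ℝ) * ((j + 1 - x) / N) ≤ j + 1 := by rw [ht]; linarith
        refine ⟨(j + 1 - x) / N, a1, a2, ?_⟩
        rw [arc_piece hN hq hr hfull e0 eN e2 hJ hj a1 a2]
        have hphi : arcPhi N full j ((j + 1 - x) / N) = s := by
          unfold arcPhi; rw [ht, hx]; field_simp; ring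
        rw [hphi]
        calc _ = ‖r j * (arcFun N full b r s - w)‖ := by congr 1; ring
          _ ≤ q * (q ^ n * (D + M)) := by
            rw [norm_mul]; gcongr; exact hr j
          _ = _ := by rw [pow_succ]; ring
      constructor
      · intro z hz
        obtain ⟨j, hj, w, hw, rfl⟩ := hE z hz
        obtain ⟨t, t0, t1, hle⟩ := step j hj w hw
        have hjN : (j : ℝ) + 1 ≤ N := by exact_mod_cast hj
        have hj0 : (0 : ℝ) ≤ j := by positivity
        exact ⟨t, by by_contra h; push Not at h; nlinarith, by by_contra h; push Not at h; nlinarith, hle⟩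
      · intro z hz
        obtain ⟨j, hj, hj2, w, hw, rfl⟩ := hE' z hz
        obtain ⟨t, t0, t1, hle⟩ := step j hj w hw
        have hjN : (j : ℝ) + 1 ≤ N := by exact_mod_cast hj
        have hj0 : (2 : ℝ) ≤ j := by exact_mod_cast hj2
        exact ⟨t, by rw [div_le_iff₀ (by linarith)]; linarith, by by_contra h; push Not at h; nlinarith, hle⟩
  have lim : Tendsto (fun n : ℕ => q ^ n * (D + M)) atTop (𝓝 0) := by
    simpa using (tendsto_pow_atTop_nhds_zero_of_lt_one hq0 (by linarith)).mul_const (D + M)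
  have hcl : IsClosed (arcFun N full b r '' (Set.Icc 0 1)) :=
    (isCompact_Icc.image_of_continuousOn (arc_cont hN hq hr hfull e0 eN e2 hJ)).isClosed
  intro z hz
  rw [← hcl.closure_eq, Metric.mem_closure_iff]
  intro ε hε
  obtain ⟨n, hn⟩ := (lim.eventually (gt_mem_nhds hε)).exists
  obtain ⟨t, t0, t1, hle⟩ := (main n).1 z hz
  exact ⟨_, ⟨t, ⟨t0, t1⟩, rfl⟩, by rw [dist_comm, dist_eq_norm]; linarith⟩

end

/-- numeric facts about the parameters -/
structure Par (a : ℤ) (α : ℂ) (q : ℝ) : Prop where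
  ha : 3 ≤ a
  root : α ^ 3 - (a : ℂ) * α ^ 2 + α - 1 = 0
  him : α.im ≠ 0
  quad : α ^ 2 = ((q - q ^ 2 : ℝ) : ℂ) * α - (q : ℂ)
  rel : q * (a - q + q ^ 2) = 1
  q0 : 0 < q
  q1 : q < 37 / 100
  nrm : ‖α‖ ^ 2 = q

lemma par_of (a : ℤ) (ha : 3 ≤ a) (α : ℂ)
    (hroot : α ^ 3 - (a : ℂ) * α ^ 2 + α - 1 = 0) (hα : α.im ≠ 0) : Par a α (‖α‖ ^ 2) := by
  set q : ℝ := ‖α‖ ^ 2 with hq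
  have hq' : q = α.re ^ 2 + α.im ^ 2 := by
    rw [hq, ← Complex.normSq_eq_norm_sq, Complex.normSq_apply]; ring
  set x := α.re with hx
  set y := α.im with hy
  have e : α = ⟨x, y⟩ := rfl
  have h1 := congrArg Complex.re hroot
  have h2 := congrArg Complex.im hroot
  simp only [e, pow_succ, pow_zero, one_mul, Complex.sub_re, Complex.add_re, Complex.mul_re,
    Complex.mul_im, Complex.intCast_re, Complex.intCast_im, Complex.one_re, Complex.zero_re,
    Complex.sub_im, Complex.add_im, Complex.one_im, Complex.zero_im] at h1 h2
  -- imaginary part divided by `y`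
  have h3 : 3 * x ^ 2 - y ^ 2 - 2 * a * x + 1 = 0 := by
    apply mul_left_cancel₀ hα
    rw [mul_zero]; linear_combination h2
  have h4 : q * (a - 2 * x) = 1 := by
    rw [hq']; linear_combination h1 - x * h3
  have hq0 : 0 < q := by rw [hq']; positivity
  have h5 : 2 * x = q - q ^ 2 := by
    linear_combination -(2 * x) * h4 - q * h3 + q * hq'
  have haR : (3 : ℝ) ≤ a := by exact_mod_cast ha
  have rel : q * (a - q + q ^ 2) = 1 := by linear_combination h4 + q * h5
  refine ⟨ha, hroot, hα, ?_, rel, hq0, ?_, rfl⟩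
  · rw [← h5]
    apply Complex.ext
    · rw [e]
      simp [pow_two]
      rw [hq']; ring
    · rw [e]
      simp [pow_two]
      ring
  · by_contra hcon
    push Not at hcon
    nlinarith [mul_nonneg hq0.le (sub_nonneg.2 haR), mul_nonneg (sub_nonneg.2 hcon) hq0.le, sq_nonneg (q - 1/3), mul_nonneg (mul_nonneg (sub_nonneg.2 hcon) hq0.le) hq0.le]

lemma Par.nlt {a : ℤ} {α : ℂ} {q : ℝ} (h : Par a α q) : ‖α‖ < 1 := by
  have := h.nrm; have := h.q1; nlinarith [norm_nonneg α]

lemma Par.ne {a : ℤ} {α : ℂ} {q : ℝ} (h : Par a α q) : α ≠ 0 := by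
  intro h0; apply h.him; rw [h0]; rfl

/-- tail sums of a digit sequence -/
def Sg (α : ℂ) (c : ℕ → ℤ) (k : ℕ) : ℂ := ∑' n : ℕ, (c (k + n) : ℂ) * α ^ n

/-- digits bounded -/
def Bd (a : ℤ) (c : ℕ → ℤ) : Prop := ∀ n, 0 ≤ c n ∧ c n ≤ a - 1

lemma term_bd {a : ℤ} {α : ℂ} {c : ℕ → ℤ} (hc : ∀ n, |c n| ≤ a - 1) (k n : ℕ) :
    ‖(c (k + n) : ℂ) * α ^ n‖ ≤ (a - 1) * ‖α‖ ^ n := by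
  rw [norm_mul, norm_pow, Complex.norm_intCast]
  gcongr
  exact_mod_cast hc (k + n)

lemma geo_sum {a : ℤ} {α : ℂ} {q : ℝ} (h : Par a α q) :
    Summable (fun n : ℕ => ((a : ℝ) - 1) * ‖α‖ ^ n) :=
  (summable_geometric_of_lt_one (norm_nonneg _) h.nlt).mul_left _

lemma Sg_summable {a : ℤ} {α : ℂ} {q : ℝ} (h : Par a α q) {c : ℕ → ℤ} (hc : ∀ n, |c n| ≤ a - 1)
    (k : ℕ) : Summable (fun n : ℕ => (c (k + n) : ℂ) * α ^ n) :=
  Summable.of_norm_bounded (geo_sum h) (term_bd hc k)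

lemma Sg_succ {a : ℤ} {α : ℂ} {q : ℝ} (h : Par a α q) {c : ℕ → ℤ} (hc : ∀ n, |c n| ≤ a - 1)
    (k : ℕ) : Sg α c k = c k + α * Sg α c (k + 1) := by
  unfold Sg
  rw [(Sg_summable h hc k).tsum_eq_zero_add, ← tsum_mul_left]
  congr 1
  · simp
  · congr 1; ext n
    rw [show k + (n + 1) = k + 1 + n by ring]; ring

lemma Sg_bound {a : ℤ} {α : ℂ} {q : ℝ} (h : Par a α q) {c : ℕ → ℤ} (hc : ∀ n, |c n| ≤ a - 1)
    (k : ℕ) : ‖Sg α c k‖ ≤ ∑' n : ℕ, ((a : ℝ) - 1) * ‖α‖ ^ n :=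
  tsum_of_norm_bounded (geo_sum h).hasSum (term_bd hc k)

lemma Sg_congr {α : ℂ} {c d : ℕ → ℤ} {k l : ℕ} (h : ∀ n, c (n + k) = d (n + l)) :
    Sg α c k = Sg α d l := by
  unfold Sg
  congr 1; ext n
  rw [add_comm k, add_comm l, h]

lemma Bd.abs {a : ℤ} {c : ℕ → ℤ} (h : Bd a c) : ∀ n, |c n| ≤ a - 1 := fun n => by
  rw [abs_of_nonneg (h n).1]; exact (h n).2

/-- the basic bound on the `α`-coordinate of a tail -/
lemma v_bound {a : ℤ} {α : ℂ} {q : ℝ} (h : Par a α q) {e : ℕ → ℤ} (he : ∀ n, |e n| ≤ a - 1)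
    (k : ℕ) : q * |(Sg α e k).im / α.im| < 2 - q := by
  have haR : (3 : ℝ) ≤ a := by exact_mod_cast h.ha
  have hq0 := h.q0
  have hq1 := h.q1
  set s : ℝ := q - q ^ 2 with hs
  set v : ℕ → ℝ := fun k => (Sg α e k).im / α.im with hv
  have hs0 : 0 < s := by rw [hs]; nlinarith
  have heR : ∀ n, |(e n : ℝ)| ≤ a - 1 := fun n => by exact_mod_cast he n
  have rec1 : ∀ k, v k = e (k + 1) + s * v (k + 1) - q * v (k + 2) := by
    intro k
    have h1 := Sg_succ h he k
    have h2 := Sg_succ h he (k + 1)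
    have h3 : Sg α e k = (e k : ℂ) + (e (k + 1) : ℂ) * α + (s : ℂ) * (Sg α e (k + 1) - e (k + 1))
        - (q : ℂ) * Sg α e (k + 2) := by
      have := h.quad
      rw [← hs] at this
      linear_combination h1 + (α - s) * h2 + Sg α e (k + 2) * this
    have h4 := congrArg Complex.im h3
    simp at h4
    have := h.him
    simp only [hv]
    field_simp
    linear_combination h4
  have rec2 : ∀ k, v k = e (k + 1) + s * e (k + 2) + (s ^ 2 - q) * v (k + 2) - s * q * v (k + 3) := by
    intro k
    have h1 := rec1 k
    have h2 := rec1 (k + 1)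
    simp only [add_assoc, Nat.reduceAdd] at h1 h2
    linear_combination h1 + s * h2
  have hbdd : BddAbove (Set.range fun k => |v k|) := by
    refine ⟨(∑' n : ℕ, ((a : ℝ) - 1) * ‖α‖ ^ n) / |α.im|, ?_⟩
    rintro _ ⟨k, rfl⟩
    simp only [hv]
    rw [abs_div]
    gcongr
    exact (Complex.abs_im_le_norm _).trans (Sg_bound h he k)
  set C := ⨆ k, |v k| with hC
  have hle : ∀ k, |v k| ≤ C := fun k => le_ciSup hbdd k
  have hqs : 0 ≤ q - s ^ 2 := by rw [hs]; nlinarith [mul_pos hq0 hq0, mul_pos (mul_pos hq0 hq0) hq0]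
  have hC' : C ≤ (a - 1) * (1 + s) + (q - s ^ 2 + s * q) * C := by
    apply ciSup_le
    intro k
    rw [rec2 k]
    have b1 := abs_le.1 (heR (k + 1))
    have b2 := abs_le.1 (heR (k + 2))
    have b3 := abs_le.1 (hle (k + 2))
    have b4 := abs_le.1 (hle (k + 3))
    have hsq : 0 ≤ s * q := by positivity
    rw [abs_le]
    constructor <;> nlinarith [mul_nonneg hs0.le (sub_nonneg.2 b2.1), mul_nonneg hs0.le (sub_nonneg.2 b2.2), mul_nonneg hqs (sub_nonneg.2 b3.1), mul_nonneg hqs (sub_nonneg.2 b3.2), mul_nonneg hsq (sub_nonneg.2 b4.1), mul_nonneg hsq (sub_nonneg.2 b4.2)]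
  have hfin : q * C < 2 - q := by
    have e1 : 1 - (q - s ^ 2 + s * q) = 1 - q - q ^ 3 + q ^ 4 := by rw [hs]; ring
    have hlam : 0 < 1 - q - q ^ 3 + q ^ 4 := by nlinarith [pow_pos hq0 3, pow_pos hq0 4, mul_pos hq0 hq0]
    have e2 : q * ((a - 1) * (1 + s)) = 1 - q ^ 2 + q ^ 3 - 2 * q ^ 4 + q ^ 5 := by
      rw [hs]; linear_combination (1 + q - q ^ 2) * h.rel
    have hpoly : 1 - q ^ 2 + q ^ 3 - 2 * q ^ 4 + q ^ 5 < (2 - q) * (1 - q - q ^ 3 + q ^ 4) := by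
      have p1 : 0 < 1 - 3 * q + 2 * q ^ 2 - 3 * q ^ 3 := by
        nlinarith [mul_pos hq0 (sub_pos.2 hq1), mul_pos (mul_pos hq0 hq0) (sub_pos.2 hq1)]
      have p2 : 0 < q ^ 4 * (5 - 2 * q) := mul_pos (by positivity) (by linarith)
      nlinarith
    have h6 : q * C * (1 - q - q ^ 3 + q ^ 4) ≤ 1 - q ^ 2 + q ^ 3 - 2 * q ^ 4 + q ^ 5 := by
      rw [← e1, ← e2]
      nlinarith
    by_contra hcon
    push Not at hcon
    nlinarith [mul_le_mul_of_nonneg_right hcon hlam.le]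
  calc q * |(Sg α e k).im / α.im| ≤ q * C := by gcongr; exact hle k
    _ < _ := hfin

/-- one step of the difference automaton, together with the two basic constraints -/
lemma step {a : ℤ} {α : ℂ} {q : ℝ} (h : Par a α q) {e : ℕ → ℤ} (he : ∀ n, |e n| ≤ a - 1)
    {k : ℕ} {x y z : ℤ} (hs : Sg α e k = x + y * α + z * α ^ 2) :
    ∃ m : ℤ, e k = x - m ∧
      Sg α e (k + 1) = ((y + m : ℤ) : ℂ) + ((z - a * m : ℤ) : ℂ) * α + (m : ℂ) * α ^ 2 ∧
      |(m : ℝ) - q * z| < 2 - q ∧ |(y : ℝ) + (1 - q) * m| < a + 1 - q := by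
  have hq0 := h.q0
  have hq1 := h.q1
  have haR : (3 : ℝ) ≤ a := by exact_mod_cast h.ha
  have h1 := Sg_succ h he k
  have h1' := Sg_succ h he (k + 1)
  have hnext : Sg α e (k + 1) = ((y + (x - e k) : ℤ) : ℂ) + ((z - a * (x - e k) : ℤ) : ℂ) * α
      + ((x - e k : ℤ) : ℂ) * α ^ 2 := by
    apply mul_left_cancel₀ h.ne
    push_cast
    linear_combination hs - h1 - ((x : ℂ) - e k) * h.root
  refine ⟨x - e k, by ring, hnext, ?_, ?_⟩
  · have hv := v_bound h he (k + 1)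
    have hval : (Sg α e (k + 1)).im / α.im
        = (z - a * (x - e k)) + (x - e k) * (q - q ^ 2) := by
      rw [hnext, h.quad]
      have := h.him
      field_simp
      simp
      ring
    rw [hval] at hv
    have : |((x - e k : ℤ) : ℝ) - q * z| = q * |((z : ℝ) - a * (x - e k)) + (x - e k) * (q - q ^ 2)| := by
      rw [← abs_of_pos hq0, ← abs_mul, abs_of_pos hq0, ← abs_neg]
      congr 1
      push_cast
      linear_combination ((x : ℝ) - e k) * h.rel
    rw [this]; exact hv
  · have hv := v_bound h he (k + 1 + 1)
    set v := (Sg α e (k + 1 + 1)).im / α.im with hvdef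
    -- the constant coordinate of the next state
    have hval : (y : ℝ) + (1 - q) * ((x - e k : ℤ) : ℝ) = e (k + 1) - q * v := by
      have hT : ∀ T : ℂ, (α * T).re - (α * T).im / α.im * α.re = -q * (T.im / α.im) := by
        intro T
        have hn : α.re ^ 2 + α.im ^ 2 = q := by
          rw [← h.nrm, ← Complex.normSq_eq_norm_sq, Complex.normSq_apply]; ring
        have := h.him
        rw [← hn]
        simp only [Complex.mul_re, Complex.mul_im]
        field_simp
        ring
      have hA := hT (Sg α e (k + 1 + 1))
      have hB : α * Sg α e (k + 1 + 1) = ((y + (x - e k) - q * (x - e k) - e (k + 1) : ℝ) : ℂ)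
          + ((z - a * (x - e k) + (x - e k) * (q - q ^ 2) : ℝ) : ℂ) * α := by
        have hqd := h.quad
        push_cast at hqd hnext ⊢
        linear_combination hnext - h1' + ((x : ℂ) - e k) * hqd
      rw [hB] at hA
      have := h.him
      simp only [Complex.add_re, Complex.add_im, Complex.mul_re, Complex.mul_im, Complex.ofReal_re,
        Complex.ofReal_im, zero_mul, add_zero, sub_zero, zero_add] at hA
      rw [mul_div_assoc, div_self this] at hA
      push_cast
      rw [hvdef]
      linarith
    rw [hval]
    have b1 : |(e (k + 1) : ℝ)| ≤ a - 1 := by exact_mod_cast he (k + 1)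
    calc |(e (k + 1) : ℝ) - q * v| ≤ |(e (k + 1) : ℝ)| + |q * v| := abs_sub _ _
      _ = |(e (k + 1) : ℝ)| + q * |v| := by rw [abs_mul, abs_of_pos hq0]
      _ < _ := by linarith

/-- difference of tails -/
def Dl (α : ℂ) (c d : ℕ → ℤ) (k : ℕ) : ℂ := Sg α d k - Sg α c k

lemma Dl_swap (α : ℂ) (c d : ℕ → ℤ) (k : ℕ) : Dl α d c k = -Dl α c d k := by
  unfold Dl; ring

def stA (a : ℤ) (α : ℂ) : ℂ := -a + α
def stF (a : ℤ) (α : ℂ) : ℂ := a * α - α ^ 2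
def stG (a : ℤ) (α : ℂ) : ℂ := (a - 1) + (a - 1) * α - α ^ 2
def stK (a : ℤ) (α : ℂ) : ℂ := (a - 1) - α
def stL (a : ℤ) (α : ℂ) : ℂ := a - (a + 1) * α + α ^ 2
def stMM (a : ℤ) (α : ℂ) : ℂ := -a - (a - 1) * α + α ^ 2

section automaton
variable {a : ℤ} {α : ℂ} {q : ℝ} (h : Par a α q) {c d : ℕ → ℤ} (hc : Bd a c) (hd : Bd a d) {k : ℕ}
include h hc hd

lemma Dl_succ (k : ℕ) : Dl α c d k = ((d k : ℂ) - c k) + α * Dl α c d (k + 1) := by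
  unfold Dl
  rw [Sg_succ h hc.abs k, Sg_succ h hd.abs k]; ring

lemma Dl_step {x y z : ℤ} (hs : Dl α c d k = x + y * α + z * α ^ 2) :
    ∃ m : ℤ, d k - c k = x - m ∧
      Dl α c d (k + 1) = ((y + m : ℤ) : ℂ) + ((z - a * m : ℤ) : ℂ) * α + (m : ℂ) * α ^ 2 ∧
      |(m : ℝ) - q * z| < 2 - q ∧ |(y : ℝ) + (1 - q) * m| < a + 1 - q := by
  have he : ∀ n, |d n - c n| ≤ a - 1 := fun n => by
    have := hc n; have := hd n
    rw [abs_le]; constructor <;> omega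
  have hD : ∀ k, Dl α c d k = Sg α (fun n => d n - c n) k := by
    intro k
    unfold Dl Sg
    rw [← (Sg_summable h hd.abs k).tsum_sub (Sg_summable h hc.abs k)]
    congr 1; ext n; push_cast; ring
  rw [hD] at hs
  obtain ⟨m, h1, h2, h3⟩ := step h he hs
  exact ⟨m, h1, by rw [hD, h2], h3⟩

lemma dO (hs : Dl α c d k = 0) : -1 ≤ d k - c k ∧ d k - c k ≤ 1 := by
  have hq0 := h.q0
  obtain ⟨m, h1, -, h3, -⟩ := Dl_step (x := 0) (y := 0) (z := 0) h hc hd (k := k) (by rw [hs]; simp)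
  rw [abs_lt] at h3
  push_cast at h3
  have m1 : m < 2 := by
    have : (m : ℝ) < (2 : ℤ) := by push_cast; linarith
    exact_mod_cast this
  have m2 : -2 < m := by
    have : ((-2 : ℤ) : ℝ) < m := by push_cast; linarith
    exact_mod_cast this
  omega

lemma dA (hs : Dl α c d k = stA a α) : c k = a - 1 ∧ d k = 0 ∧ Dl α c d (k + 1) = stF a α := by
  have hq0 := h.q0
  obtain ⟨m, h1, h2, h3, -⟩ := Dl_step (x := -a) (y := 1) (z := 0) h hc hd (k := k)
    (by rw [hs, stA]; push_cast; ring)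
  rw [abs_lt] at h3
  push_cast at h3
  have m2 : -2 < m := by
    have : ((-2 : ℤ) : ℝ) < m := by push_cast; linarith
    exact_mod_cast this
  have := hc k; have := hd k
  have hm : m = -1 := by omega
  refine ⟨by omega, by omega, ?_⟩
  rw [h2, hm, stF]; push_cast; ring

lemma dF (hs : Dl α c d k = stF a α) : (d k = c k ∧ Dl α c d (k + 1) = -stA a α) ∨
    (d k = c k + 1 ∧ Dl α c d (k + 1) = stG a α) := by
  have hq0 := h.q0
  have hq1 := h.q1
  obtain ⟨m, h1, h2, h3, h4⟩ := Dl_step (x := 0) (y := a) (z := -1) h hc hd (k := k)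
    (by rw [hs, stF]; push_cast; ring)
  rw [abs_lt] at h3 h4
  push_cast at h3
  have m2 : -2 < m := by
    have : ((-2 : ℤ) : ℝ) < m := by push_cast; linarith
    exact_mod_cast this
  have m1 : m < 1 := by
    have : (m : ℝ) < (1 : ℤ) := by push_cast; nlinarith
    exact_mod_cast this
  have hm : m = 0 ∨ m = -1 := by omega
  rcases hm with hm | hm
  · left; refine ⟨by omega, ?_⟩
    rw [h2, hm, stA]; push_cast; ring
  · right; refine ⟨by omega, ?_⟩
    rw [h2, hm, stG]; push_cast; ring

lemma dG (hs : Dl α c d k = stG a α) : (d k - c k = a - 1 ∧ Dl α c d (k + 1) = stK a α) ∨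
    (d k - c k = a - 2 ∧ Dl α c d (k + 1) = stL a α) := by
  have hq0 := h.q0
  have hq1 := h.q1
  obtain ⟨m, h1, h2, h3, h4⟩ := Dl_step (x := a - 1) (y := a - 1) (z := -1) h hc hd (k := k)
    (by rw [hs, stG]; push_cast; ring)
  rw [abs_lt] at h3 h4
  push_cast at h3
  have m1 : m < 2 := by
    have : (m : ℝ) < (2 : ℤ) := by push_cast; linarith
    exact_mod_cast this
  have := hc k; have := hd k
  have hm : m = 0 ∨ m = 1 := by omega
  rcases hm with hm | hm
  · left; refine ⟨by omega, ?_⟩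
    rw [h2, hm, stK]; push_cast; ring
  · right; refine ⟨by omega, ?_⟩
    rw [h2, hm, stL]; push_cast; ring

lemma dK (hs : Dl α c d k = stK a α) : (d k - c k = a - 1) ∨
    (d k - c k = a - 2 ∧ Dl α c d (k + 1) = -stF a α) := by
  have hq0 := h.q0
  have hq1 := h.q1
  obtain ⟨m, h1, h2, h3, h4⟩ := Dl_step (x := a - 1) (y := -1) (z := 0) h hc hd (k := k)
    (by rw [hs, stK]; push_cast; ring)
  rw [abs_lt] at h3 h4
  push_cast at h3
  have m1 : m < 2 := by
    have : (m : ℝ) < (2 : ℤ) := by push_cast; linarith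
    exact_mod_cast this
  have := hc k; have := hd k
  have hm : m = 0 ∨ m = 1 := by omega
  rcases hm with hm | hm
  · left; omega
  · right; refine ⟨by omega, ?_⟩
    rw [h2, hm, stF]; push_cast; ring

lemma dL (hs : Dl α c d k = stL a α) : d k = a - 1 ∧ c k = 0 ∧ Dl α c d (k + 1) = stMM a α := by
  have hq0 := h.q0
  have hq1 := h.q1
  obtain ⟨m, h1, h2, h3, h4⟩ := Dl_step (x := a) (y := -a - 1) (z := 1) h hc hd (k := k)
    (by rw [hs, stL]; push_cast; ring)
  rw [abs_lt] at h3 h4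
  push_cast at h3
  have m1 : m < 2 := by
    have : (m : ℝ) < (2 : ℤ) := by push_cast; linarith
    exact_mod_cast this
  have := hc k; have := hd k
  have hm : m = 1 := by omega
  refine ⟨by omega, by omega, ?_⟩
  rw [h2, hm, stMM]; push_cast; ring

lemma dM (hs : Dl α c d k = stMM a α) : c k = a - 1 ∧ d k = 0 ∧ Dl α c d (k + 1) = -stL a α := by
  have hq0 := h.q0
  have hq1 := h.q1
  obtain ⟨m, h1, h2, h3, h4⟩ := Dl_step (x := -a) (y := 1 - a) (z := 1) h hc hd (k := k)
    (by rw [hs, stMM]; push_cast; ring)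
  rw [abs_lt] at h3 h4
  push_cast at h3
  have m1 : -2 < m := by
    have : ((-2 : ℤ) : ℝ) < m := by push_cast; linarith
    exact_mod_cast this
  have := hc k; have := hd k
  have hm : m = -1 := by omega
  refine ⟨by omega, by omega, ?_⟩
  rw [h2, hm, stL]; push_cast; ring

lemma dL_sum (hs : Dl α c d k = stL a α) : ∀ n, d (k + n) + c (k + n) = a - 1 := by
  have key : ∀ n, Dl α c d (k + n) = stL a α ∨ Dl α c d (k + n) = stMM a α ∨
      Dl α d c (k + n) = stL a α ∨ Dl α d c (k + n) = stMM a α := by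
    intro n
    induction n with
    | zero => left; exact hs
    | succ n ih =>
      rw [← add_assoc]
      rcases ih with i | i | i | i
      · right; left; exact (dL h hc hd i).2.2
      · right; right; left; rw [Dl_swap, (dM h hc hd i).2.2]; ring
      · right; right; right; exact (dL h hd hc i).2.2
      · left; rw [Dl_swap, (dM h hd hc i).2.2]; ring
  intro n
  rcases key n with i | i | i | i
  · have := dL h hc hd i; omega
  · have := dM h hc hd i; omega
  · have := dL h hd hc i; omega
  · have := dM h hd hc i; omega

lemma dL_val (hs : Dl α c d k = stL a α) : α * Sg α c k = -1 := by
  have hn := h.nlt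
  have h1 : Sg α c k + Sg α d k = ((a : ℂ) - 1) * (1 - α)⁻¹ := by
    rw [← tsum_geometric_of_norm_lt_one hn, ← tsum_mul_left]
    unfold Sg
    rw [← (Sg_summable h hc.abs k).tsum_add (Sg_summable h hd.abs k)]
    congr 1; ext n
    have : ((d (k + n) : ℂ) + c (k + n)) = a - 1 := by exact_mod_cast dL_sum h hc hd hs n
    linear_combination α ^ n * this
  have hne : (1 - α) ≠ 0 := by
    intro h0
    have : α = 1 := by linear_combination -h0
    rw [this] at hn; simp at hn
  have h2 : (Sg α c k + Sg α d k) * (1 - α) = (a : ℂ) - 1 := by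
    rw [h1, mul_assoc, inv_mul_cancel₀ hne, mul_one]
  unfold Dl stL at hs
  have h3 : (α * Sg α c k + 1) * (2 * (1 - α)) = 0 := by
    linear_combination α * h2 - α * (1 - α) * hs + (α - 2) * h.root
  rcases mul_eq_zero.1 h3 with h4 | h4
  · linear_combination h4
  · rcases mul_eq_zero.1 h4 with h5 | h5
    · norm_num at h5
    · exact absurd h5 hne

lemma dL_val' (hs : Dl α c d k = stL a α) : α * Sg α d k = -1 + α * stL a α := by
  have := dL_val h hc hd hs
  unfold Dl at hs
  linear_combination this + α * hs

end automaton

/-- admissible sequences indexed by `ℕ` -/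
def Adm (a : ℤ) (c : ℕ → ℤ) : Prop :=
  Bd a c ∧ ∀ n, WordLt a (c (n + 3)) (c (n + 2)) (c (n + 1)) (c n)

/-- pairs of expansions defining a point of `B_{α-1}` -/
structure Pair (a : ℤ) (α : ℂ) (c d : ℕ → ℤ) : Prop where
  hc : Adm a c
  hd : Adm a d
  dl : Dl α c d 0 = stA a α

section pairs
variable {a : ℤ} {α : ℂ} {q : ℝ} (h : Par a α q) {c d : ℕ → ℤ} (hp : Pair a α c d)
include h hp

lemma Pair.zero : c 0 = a - 1 ∧ d 0 = 0 ∧ Dl α c d 1 = stF a α := dA h hp.hc.1 hp.hd.1 hp.dl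

/-- consequences in the even case -/
lemma Pair.even (h2 : Dl α c d 2 = -stA a α) :
    c 2 = 0 ∧ d 2 = a - 1 ∧ Dl α d c 3 = stF a α := by
  have := dA h hp.hd.1 hp.hc.1 (k := 2) (by rw [Dl_swap, h2, neg_neg])
  exact ⟨this.2.1, this.1, this.2.2⟩

lemma Pair.cases : (c 1 = d 1 ∧ Dl α c d 2 = -stA a α) ∨
    (d 1 = c 1 + 1 ∧ c 2 = 0 ∧
      ((d 2 = a - 1 ∧ c 3 = 0 ∧ d 3 = a - 2 ∧ Dl α d c 4 = stF a α) ∨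
       (d 2 = a - 2 ∧ Dl α c d 3 = stL a α))) := by
  have ha := h.ha
  obtain ⟨c0, d0, s1⟩ := hp.zero h
  rcases dF h hp.hc.1 hp.hd.1 s1 with ⟨e1, s2⟩ | ⟨e1, s2⟩
  · left; exact ⟨e1.symm, s2⟩
  · right
    have bc1 := hp.hc.1 1
    have bc2 := hp.hc.1 2
    have bd2 := hp.hd.1 2
    have bc3 := hp.hc.1 3
    have bd3 := hp.hd.1 3
    have w0 := hp.hd.2 0
    simp only [Nat.reduceAdd, zero_add] at s2 w0
    unfold WordLt at w0
    rcases dG h hp.hc.1 hp.hd.1 s2 with ⟨e2, s3⟩ | ⟨e2, s3⟩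
    · simp only [Nat.reduceAdd] at s3
      rcases dK h hp.hc.1 hp.hd.1 s3 with e3 | ⟨e3, s4⟩
      · omega
      · refine ⟨e1, by omega, Or.inl ⟨by omega, by omega, by omega, ?_⟩⟩
        rw [Dl_swap, s4, neg_neg]
    · simp only [Nat.reduceAdd] at s3
      have h3 := dL h hp.hc.1 hp.hd.1 s3
      have h4 := dM h hp.hc.1 hp.hd.1 h3.2.2
      have h5 := dL h hp.hd.1 hp.hc.1 (k := 5) (by rw [Dl_swap, h4.2.2, neg_neg])
      have w2 := hp.hc.2 2
      simp only [Nat.reduceAdd] at w2 h4 h5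
      unfold WordLt at w2
      refine ⟨e1, by omega, Or.inr ⟨by omega, s3⟩⟩

lemma Pair.c2 : c 2 = 0 := by
  rcases hp.cases h with ⟨_, s⟩ | ⟨_, s, _⟩
  · exact (hp.even h s).1
  · exact s

/-- prepending digits, odd maps -/
lemma Pair.odd_map {κ : ℤ} (k0 : 0 ≤ κ) (k1 : κ ≤ a - 2) : ∃ c' d', Pair a α c' d' ∧
    c' 1 = κ ∧ d' 1 = κ + 1 ∧ c' 2 = 0 ∧ d' 2 = a - 1 ∧ c' 3 = 0 ∧ d' 3 = a - 2 ∧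
    Dl α d' c' 4 = stF a α ∧
    α ^ 2 * Sg α c' 0 = -1 - (a - 2 - κ) * α ^ 3 + α ^ 3 * (α ^ 2 * Sg α c 0) := by
  have ha := h.ha
  obtain ⟨c0, d0, s1⟩ := hp.zero h
  have hc2 := hp.c2 h
  have wd0 := hp.hd.2 0
  have wc0 := hp.hc.2 0
  simp only [Nat.reduceAdd, zero_add] at wd0 wc0
  set c' : ℕ → ℤ := fun n => match n with
    | 0 => a - 1 | 1 => κ | 2 => 0 | 3 => 0 | n + 4 => d (n + 1) with hc'
  set d' : ℕ → ℤ := fun n => match n with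
    | 0 => 0 | 1 => κ + 1 | 2 => a - 1 | 3 => a - 2 | n + 4 => c (n + 1) with hd'
  have bc : Bd a c' := by
    rintro (_ | _ | _ | _ | n) <;> simp only [hc']
    · omega
    · omega
    · omega
    · omega
    · exact hp.hd.1 (n + 1)
  have bd : Bd a d' := by
    rintro (_ | _ | _ | _ | n) <;> simp only [hd']
    · omega
    · omega
    · omega
    · omega
    · exact hp.hc.1 (n + 1)
  have ac : Adm a c' := by
    refine ⟨bc, ?_⟩
    have b1 := hp.hd.1 1
    have b2 := hp.hd.1 2
    have b3 := hp.hd.1 3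
    rintro (_ | _ | _ | _ | n)
    · simp only [hc', WordLt]; omega
    · simp only [hc', WordLt, Nat.reduceAdd, zero_add]; omega
    · change WordLt a (d 2) (d 1) 0 0
      unfold WordLt; omega
    · rw [d0] at wd0; exact wd0
    · exact hp.hd.2 (n + 1)
  have ad : Adm a d' := by
    refine ⟨bd, ?_⟩
    have b1 := hp.hc.1 1
    have b3 := hp.hc.1 3
    rintro (_ | _ | _ | _ | n)
    · simp only [hd', WordLt]; omega
    · simp only [hd', WordLt, Nat.reduceAdd, zero_add]; omega
    · simp only [hd', WordLt, Nat.reduceAdd, zero_add]; omega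
    · simp only [hd', WordLt, Nat.reduceAdd, zero_add] at wc0 ⊢; omega
    · exact hp.hc.2 (n + 1)
  have tc : Sg α c' 4 = Sg α d 1 := Sg_congr fun n => rfl
  have td : Sg α d' 4 = Sg α c 1 := Sg_congr fun n => rfl
  have f4 : Dl α d' c' 4 = stF a α := by rw [← s1]; unfold Dl; rw [tc, td]
  have ec0 := Sg_succ h bc.abs 0
  have ec1 := Sg_succ h bc.abs 1
  have ec2 := Sg_succ h bc.abs 2
  have ec3 := Sg_succ h bc.abs 3
  have eD0 := Dl_succ h bc bd 0
  have eD1 := Dl_succ h bc bd 1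
  have eD2 := Dl_succ h bc bd 2
  have eD3 := Dl_succ h bc bd 3
  have f4' : Dl α c' d' 4 = -stF a α := by rw [Dl_swap, f4]
  have ecc := Sg_succ h hp.hc.1.abs 0
  have eDD := hp.dl
  unfold Dl stF at s1
  unfold stF at f4'
  simp only [hc', hd', Nat.reduceAdd, zero_add] at ec0 ec1 ec2 ec3 eD0 eD1 eD2 eD3
  simp only [← hc', ← hd'] at ec0 ec1 ec2 ec3 eD0 eD1 eD2 eD3
  rw [c0] at ecc
  push_cast at ec0 ec1 ec2 ec3 eD0 eD1 eD2 eD3 ecc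
  refine ⟨c', d', ⟨ac, ad, ?_⟩, rfl, rfl, rfl, rfl, rfl, rfl, f4, ?_⟩
  · unfold stA
    linear_combination eD0 + α * eD1 + α ^ 2 * eD2 + α ^ 3 * eD3 + α ^ 4 * f4' + (α ^ 3 - α - 1) * h.root
  · linear_combination α ^ 2 * (ec0 + α * ec1 + α ^ 2 * ec2 + α ^ 3 * ec3 + α ^ 4 * tc + α ^ 4 * s1) - α ^ 5 * ecc + (-α ^ 5 + α ^ 3 - α - 1) * h.root

/-- prepending digits, even maps -/
lemma Pair.even_map {κ : ℤ} (k0 : 0 ≤ κ) (k1 : κ ≤ a - 1) (hk : κ = 0 ∨ d 1 ≠ a - 1) :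
    ∃ c' d', Pair a α c' d' ∧ c' 1 = κ ∧ d' 1 = κ ∧ Dl α c' d' 2 = -stA a α ∧
    α ^ 2 * Sg α c' 0 = α - 1 + κ * α ^ 3 + α ^ 2 * (α ^ 2 * Sg α c 0) := by
  have ha := h.ha
  obtain ⟨c0, d0, s1⟩ := hp.zero h
  have hc2 := hp.c2 h
  have hc1 : κ = 0 ∨ c 1 ≠ a - 1 := by
    rcases hk with hk | hk
    · exact Or.inl hk
    · right
      have := hp.hd.1 1
      rcases hp.cases h with ⟨e, _⟩ | ⟨e, _⟩ <;> omega
  set c' : ℕ → ℤ := fun n => match n with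
    | 0 => a - 1 | 1 => κ | n + 2 => d n with hc'
  set d' : ℕ → ℤ := fun n => match n with
    | 0 => 0 | 1 => κ | n + 2 => c n with hd'
  have bc : Bd a c' := by
    rintro (_ | _ | n) <;> simp only [hc']
    · omega
    · omega
    · exact hp.hd.1 n
  have bd : Bd a d' := by
    rintro (_ | _ | n) <;> simp only [hd']
    · omega
    · omega
    · exact hp.hc.1 n
  have ac : Adm a c' := by
    refine ⟨bc, ?_⟩
    have b1 := hp.hd.1 1
    have b2 := hp.hd.1 2
    rintro (_ | _ | n)
    · simp only [hc', WordLt]; omega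
    · simp only [hc', WordLt, Nat.reduceAdd, zero_add]; omega
    · exact hp.hd.2 n
  have ad : Adm a d' := by
    refine ⟨bd, ?_⟩
    have b1 := hp.hc.1 1
    rintro (_ | _ | n)
    · simp only [hd', WordLt]; omega
    · simp only [hd', WordLt, Nat.reduceAdd, zero_add]; omega
    · exact hp.hc.2 n
  have tc : Sg α c' 2 = Sg α d 0 := Sg_congr fun n => rfl
  have td : Sg α d' 2 = Sg α c 0 := Sg_congr fun n => rfl
  have f2 : Dl α c' d' 2 = -stA a α := by rw [← hp.dl]; unfold Dl; rw [tc, td]; ring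
  have ec0 := Sg_succ h bc.abs 0
  have ec1 := Sg_succ h bc.abs 1
  have eD0 := Dl_succ h bc bd 0
  have eD1 := Dl_succ h bc bd 1
  have f2' := f2
  unfold stA at f2'
  have hdl := hp.dl
  unfold Dl stA at hdl
  simp only [hc', hd', Nat.reduceAdd, zero_add] at ec0 ec1 eD0 eD1
  simp only [← hc', ← hd'] at ec0 ec1 eD0 eD1
  push_cast at ec0 ec1 eD0 eD1
  refine ⟨c', d', ⟨ac, ad, ?_⟩, rfl, rfl, f2, ?_⟩
  · unfold stA
    linear_combination eD0 + α * eD1 + α ^ 2 * f2' - h.root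
  · linear_combination α ^ 2 * (ec0 + α * ec1 + α ^ 2 * tc + α ^ 2 * hdl) + (α ^ 2 - 1) * h.root

end pairs

/-- pieces: all points coming from a pair -/
def WW (a : ℤ) (α : ℂ) : Set ℂ := {z | ∃ c d, Pair a α c d ∧ z = α ^ 2 * Sg α c 0}

/-- points coming from a pair with second digit of `d` not maximal -/
def WW' (a : ℤ) (α : ℂ) : Set ℂ :=
  {z | ∃ c d, Pair a α c d ∧ d 1 ≠ a - 1 ∧ z = α ^ 2 * Sg α c 0}

lemma rauzy_iff (a : ℤ) (α z : ℂ) :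
    z ∈ Rauzy a α ↔ ∃ c : ℕ → ℤ, Adm a c ∧ z = α ^ 2 * Sg α c 0 := by
  constructor
  · rintro ⟨c, ⟨h1, h2⟩, rfl⟩
    refine ⟨fun n => c ((n : ℤ) + 2), ⟨fun n => h1 _ (by omega), fun n => ?_⟩, ?_⟩
    · have := h2 ((n : ℤ) + 5) (by omega)
      have e1 : (n : ℤ) + 5 = ((n + 3 : ℕ) : ℤ) + 2 := by push_cast; ring
      have e2 : (n : ℤ) + 5 - 1 = ((n + 2 : ℕ) : ℤ) + 2 := by push_cast; ring
      have e3 : (n : ℤ) + 5 - 2 = ((n + 1 : ℕ) : ℤ) + 2 := by push_cast; ring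
      have e4 : (n : ℤ) + 5 - 3 = (n : ℤ) + 2 := by ring
      rw [e2, e3, e4, e1] at this
      exact this
    · unfold Sg
      rw [← tsum_mul_left]
      congr 1; ext n
      simp only [zero_add]
      ring
  · rintro ⟨c, ⟨h1, h2⟩, rfl⟩
    refine ⟨fun i => c (i - 2).toNat, ⟨fun i _ => h1 _, fun i hi => ?_⟩, ?_⟩
    · have := h2 (i - 5).toNat
      have e1 : (i - 2).toNat = (i - 5).toNat + 3 := by omega
      have e2 : (i - 1 - 2).toNat = (i - 5).toNat + 2 := by omega
      have e3 : (i - 2 - 2).toNat = (i - 5).toNat + 1 := by omega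
      have e4 : (i - 3 - 2).toNat = (i - 5).toNat := by omega
      simp only [e1, e2, e3, e4]
      exact this
    · unfold Sg
      rw [← tsum_mul_left]
      congr 1; ext n
      have : ((n : ℤ) + 2 - 2).toNat = n := by omega
      simp only [zero_add, this]
      ring

lemma dl_iff {a : ℤ} {α : ℂ} {q : ℝ} (h : Par a α q) (c d : ℕ → ℤ) :
    α ^ 2 * Sg α c 0 = α ^ 2 * Sg α d 0 + (α - 1) ↔ Dl α c d 0 = stA a α := by
  unfold Dl stA
  constructor
  · intro e
    have : α ^ 2 * (Sg α d 0 - Sg α c 0 - (-a + α)) = 0 := by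
      linear_combination -e - h.root
    rcases mul_eq_zero.1 this with h1 | h1
    · exact absurd h1 (pow_ne_zero 2 h.ne)
    · linear_combination h1
  · intro e
    linear_combination -α ^ 2 * e - h.root

lemma bset_eq {a : ℤ} {α : ℂ} {q : ℝ} (h : Par a α q) : BSet a α (α - 1) = WW a α := by
  ext z
  constructor
  · rintro ⟨h1, y, h2, h3⟩
    obtain ⟨c, hc, rfl⟩ := (rauzy_iff _ _ _).1 h1
    obtain ⟨d, hd, rfl⟩ := (rauzy_iff _ _ _).1 h2
    exact ⟨c, d, ⟨hc, hd, (dl_iff h c d).1 h3.symm⟩, rfl⟩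
  · rintro ⟨c, d, hp, rfl⟩
    exact ⟨(rauzy_iff _ _ _).2 ⟨c, hp.hc, rfl⟩, α ^ 2 * Sg α d 0, (rauzy_iff _ _ _).2 ⟨d, hp.hd, rfl⟩,
      ((dl_iff h c d).2 hp.dl).symm⟩

/-- compactness of digit-restricted pieces -/
lemma cpt {a : ℤ} {α : ℂ} {q : ℝ} (h : Par a α q) (Q : ℤ → Prop) :
    IsCompact {z | ∃ c : ℕ → ℤ, Adm a c ∧ Q (c 1) ∧ z = α ^ 2 * Sg α c 0} := by
  have K0 : IsCompact (Set.pi Set.univ (fun _ : ℕ => Set.Icc (0 : ℤ) (a - 1))) :=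
    isCompact_univ_pi fun _ => (Set.finite_Icc _ _).isCompact
  have C1 : IsClosed {c : ℕ → ℤ | ∀ n, WordLt a (c (n + 3)) (c (n + 2)) (c (n + 1)) (c n)} := by
    rw [Set.ofPred_forall]
    refine isClosed_iInter fun n => ?_
    have hcont : Continuous fun c : ℕ → ℤ => (c (n + 3), c (n + 2), c (n + 1), c n) := by fun_prop
    exact (isClosed_discrete {p : ℤ × ℤ × ℤ × ℤ | WordLt a p.1 p.2.1 p.2.2.1 p.2.2.2}).preimage hcont
  have C2 : IsClosed {c : ℕ → ℤ | Q (c 1)} :=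
    (isClosed_discrete {x : ℤ | Q x}).preimage (continuous_apply 1)
  have K := (K0.inter_right C1).inter_right C2
  have hcont : ContinuousOn (fun c : ℕ → ℤ => α ^ 2 * Sg α c 0)
      (Set.pi Set.univ (fun _ : ℕ => Set.Icc (0 : ℤ) (a - 1))) := by
    apply ContinuousOn.mul continuousOn_const
    unfold Sg
    have hs : Summable fun n : ℕ => ((a : ℝ) - 1) * ‖α‖ ^ n :=
      (summable_geometric_of_lt_one (norm_nonneg _) h.nlt).mul_left _
    refine continuousOn_tsum (u := fun n => ((a : ℝ) - 1) * ‖α‖ ^ n) ?_ hs ?_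
    · intro n
      apply Continuous.continuousOn
      have : Continuous fun x : ℤ => (x : ℂ) := continuous_of_discreteTopology
      exact (this.comp (continuous_apply (0 + n))).mul continuous_const
    · intro n c hc
      rw [norm_mul, norm_pow]
      apply mul_le_mul_of_nonneg_right _ (by positivity)
      have h1 := hc (0 + n) (Set.mem_univ _)
      rw [Complex.norm_intCast, abs_le]
      have h2 : (0 : ℝ) ≤ c (0 + n) := by exact_mod_cast h1.1
      have h3 : (c (0 + n) : ℝ) ≤ a - 1 := by exact_mod_cast h1.2
      constructor <;> linarith
  have := K.image_of_continuousOn (hcont.mono (fun c hc => hc.1.1))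
  convert this using 1
  ext z
  constructor
  · rintro ⟨c, hc, hQ, rfl⟩
    exact ⟨c, ⟨⟨fun n _ => hc.1 n, hc.2⟩, hQ⟩, rfl⟩
  · rintro ⟨c, ⟨⟨h1, h2⟩, h3⟩, rfl⟩
    exact ⟨c, ⟨fun n => h1 n (Set.mem_univ _), h2⟩, h3, rfl⟩

lemma WW'_cpt {a : ℤ} {α : ℂ} {q : ℝ} (h : Par a α q) (Q : ℤ → Prop) :
    IsCompact {z | ∃ c d, Pair a α c d ∧ Q (d 1) ∧ z = α ^ 2 * Sg α c 0} := by
  have K1 := cpt h (fun _ => True)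
  have K2 := (cpt h Q).image (f := fun z => z + (α - 1)) (by fun_prop)
  convert K1.inter K2 using 1
  ext z
  constructor
  · rintro ⟨c, d, hp, hQ, rfl⟩
    exact ⟨⟨c, hp.hc, trivial, rfl⟩, α ^ 2 * Sg α d 0, ⟨d, hp.hd, hQ, rfl⟩,
      ((dl_iff h c d).2 hp.dl).symm⟩
  · rintro ⟨⟨c, hc, -, rfl⟩, y, ⟨d, hd, hQ, rfl⟩, h3⟩
    exact ⟨c, d, ⟨hc, hd, (dl_iff h c d).1 h3.symm⟩, hQ, rfl⟩

lemma WW_compact {a : ℤ} {α : ℂ} {q : ℝ} (h : Par a α q) : IsCompact (WW a α) := by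
  have := WW'_cpt h (fun _ => True)
  simpa [WW] using this

lemma WW'_compact {a : ℤ} {α : ℂ} {q : ℝ} (h : Par a α q) : IsCompact (WW' a α) :=
  WW'_cpt h (fun x => x ≠ a - 1)

lemma WW'_sub {a : ℤ} {α : ℂ} : WW' a α ⊆ WW a α := by
  rintro z ⟨c, d, hp, -, rfl⟩
  exact ⟨c, d, hp, rfl⟩

/-- the endpoint `α - 1 - α²` is in the second piece -/
lemma qq_mem {a : ℤ} {α : ℂ} {q : ℝ} (h : Par a α q) : α - 1 - α ^ 2 ∈ WW' a α := by
  have ha := h.ha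
  set c : ℕ → ℤ := fun n => if n % 4 = 0 ∨ n % 4 = 3 then a - 1 else 0 with hc
  set d : ℕ → ℤ := fun n => if n % 4 = 2 ∨ n % 4 = 3 then a - 1 else 0 with hd
  have bc : Bd a c := by
    intro n; simp only [hc]; split_ifs <;> omega
  have bd : Bd a d := by
    intro n; simp only [hd]; split_ifs <;> omega
  have ac : Adm a c := by
    refine ⟨bc, fun n => ?_⟩
    simp only [hc, WordLt]
    split_ifs <;> omega
  have ad : Adm a d := by
    refine ⟨bd, fun n => ?_⟩
    simp only [hd, WordLt]
    split_ifs <;> omega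
  have pc : Sg α c 4 = Sg α c 0 := Sg_congr fun n => by simp [hc]
  have pd : Sg α d 4 = Sg α d 0 := Sg_congr fun n => by simp [hd]
  have hne4 : (1 - α ^ 4) ≠ 0 := by
    intro h0
    have h1 : ‖α ^ 4‖ = 1 := by
      have : α ^ 4 = 1 := by linear_combination -h0
      rw [this]; simp
    rw [norm_pow] at h1
    have : ‖α‖ ^ 4 < 1 := pow_lt_one₀ (norm_nonneg _) h.nlt (by norm_num)
    linarith
  have ec0 := Sg_succ h bc.abs 0
  have ec1 := Sg_succ h bc.abs 1
  have ec2 := Sg_succ h bc.abs 2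
  have ec3 := Sg_succ h bc.abs 3
  have ed0 := Sg_succ h bd.abs 0
  have ed1 := Sg_succ h bd.abs 1
  have ed2 := Sg_succ h bd.abs 2
  have ed3 := Sg_succ h bd.abs 3
  have c0 : c 0 = a - 1 := rfl
  have c1 : c 1 = 0 := rfl
  have c2 : c 2 = 0 := rfl
  have c3 : c 3 = a - 1 := rfl
  have d0 : d 0 = 0 := rfl
  have d1 : d 1 = 0 := rfl
  have d2 : d 2 = a - 1 := rfl
  have d3 : d 3 = a - 1 := rfl
  rw [c0] at ec0; rw [c1] at ec1; rw [c2] at ec2; rw [c3] at ec3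
  rw [d0] at ed0; rw [d1] at ed1; rw [d2] at ed2; rw [d3] at ed3
  simp only [Nat.reduceAdd, zero_add] at ec0 ec1 ec2 ec3 ed0 ed1 ed2 ed3
  push_cast at ec0 ec1 ec2 ec3 ed0 ed1 ed2 ed3
  have vc : (1 - α ^ 4) * (α ^ 2 * Sg α c 0 - (α - 1 - α ^ 2)) = 0 := by
    linear_combination α ^ 2 * (ec0 + α * ec1 + α ^ 2 * ec2 + α ^ 3 * ec3 + α ^ 4 * pc) +
      (-(α ^ 3 + 1)) * h.root
  have vd : (1 - α ^ 4) * (α ^ 2 * Sg α d 0 + α ^ 2) = 0 := by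
    linear_combination α ^ 2 * (ed0 + α * ed1 + α ^ 2 * ed2 + α ^ 3 * ed3 + α ^ 4 * pd) +
      (-(α ^ 2 * (α + 1))) * h.root
  have vc' : α ^ 2 * Sg α c 0 = α - 1 - α ^ 2 := by
    linear_combination (mul_eq_zero.1 vc).resolve_left hne4
  have vd' := (mul_eq_zero.1 vd).resolve_left hne4
  refine ⟨c, d, ⟨ac, ad, (dl_iff h c d).1 ?_⟩, ?_, vc'.symm⟩
  · rw [vc']; linear_combination -vd'
  · rw [d1]; omega

/-- even map with digit `κ` -/
def ev (α : ℂ) (κ : ℤ) (w : ℂ) : ℂ := α - 1 + κ * α ^ 3 + α ^ 2 * w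

/-- odd map with digit `κ` -/
def od (a : ℤ) (α : ℂ) (κ : ℤ) (w : ℂ) : ℂ := -1 - (a - 2 - κ) * α ^ 3 + α ^ 3 * w

section maps
variable {a : ℤ} {α : ℂ} {q : ℝ} (h : Par a α q)
include h

lemma ev_mem {κ : ℤ} (k0 : 0 ≤ κ) (k1 : κ ≤ a - 1) {w : ℂ} (hw : w ∈ WW a α)
    (hk : κ = 0 ∨ w ∈ WW' a α) : ∃ c d, Pair a α c d ∧ c 1 = κ ∧ d 1 = κ ∧
      Dl α c d 2 = -stA a α ∧ α ^ 2 * Sg α c 0 = ev α κ w := by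
  rcases hk with hk | ⟨c, d, hp, h1, rfl⟩
  · obtain ⟨c, d, hp, rfl⟩ := hw
    exact hp.even_map h k0 k1 (Or.inl hk)
  · exact hp.even_map h k0 k1 (Or.inr h1)

lemma od_mem {κ : ℤ} (k0 : 0 ≤ κ) (k1 : κ ≤ a - 2) {w : ℂ} (hw : w ∈ WW a α) :
    ∃ c d, Pair a α c d ∧ c 1 = κ ∧ d 1 = κ + 1 ∧ c 2 = 0 ∧ d 2 = a - 1 ∧ c 3 = 0 ∧ d 3 = a - 2 ∧
      Dl α d c 4 = stF a α ∧ α ^ 2 * Sg α c 0 = od a α κ w := by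
  obtain ⟨c, d, hp, rfl⟩ := hw
  exact hp.odd_map h k0 k1

lemma pp_eq : ev α (a - 2) (α - 1 - α ^ 2) = -1 - α ^ 3 := by
  unfold ev; push_cast; linear_combination -α * h.root

lemma pp_mem : -1 - α ^ 3 ∈ WW' a α := by
  have ha := h.ha
  obtain ⟨c, d, hp, -, h1, -, e⟩ := ev_mem h (κ := a - 2) (by omega) (by omega) (WW'_sub (qq_mem h))
    (Or.inr (qq_mem h))
  exact ⟨c, d, hp, by omega, by rw [e, pp_eq h]⟩

/-- exhaustion -/
lemma exhaust {c d : ℕ → ℤ} (hp : Pair a α c d) :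
    (∃ κ w, 0 ≤ κ ∧ κ ≤ a - 1 ∧ (d 1 ≠ a - 1 → κ ≠ a - 1) ∧ w ∈ WW a α ∧ (κ = 0 ∨ w ∈ WW' a α) ∧
      α ^ 2 * Sg α c 0 = ev α κ w) ∨
    (∃ κ w, 0 ≤ κ ∧ κ ≤ a - 2 ∧ (d 1 ≠ a - 1 → κ ≠ a - 2) ∧ w ∈ WW a α ∧
      α ^ 2 * Sg α c 0 = od a α κ w) := by
  have ha := h.ha
  obtain ⟨c0, d0, s1⟩ := hp.zero h
  have bc1 := hp.hc.1 1
  have bd1 := hp.hd.1 1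
  have ec0 := Sg_succ h hp.hc.1.abs 0
  have ec1 := Sg_succ h hp.hc.1.abs 1
  have ec2 := Sg_succ h hp.hc.1.abs 2
  have ec3 := Sg_succ h hp.hc.1.abs 3
  rw [c0] at ec0
  simp only [Nat.reduceAdd, zero_add] at ec0 ec1 ec2 ec3
  push_cast at ec0
  rcases hp.cases h with ⟨e1, s2⟩ | ⟨e1, c2, ⟨d2, c3, d3, s4⟩ | ⟨d2, s3⟩⟩
  · left
    obtain ⟨c2, d2, s3⟩ := hp.even h s2
    have np : Pair a α (fun n => d (n + 2)) (fun n => c (n + 2)) := by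
      refine ⟨⟨fun n => hp.hd.1 _, fun n => hp.hd.2 (n + 2)⟩,
        ⟨fun n => hp.hc.1 _, fun n => hp.hc.2 (n + 2)⟩, ?_⟩
      have t1 : Sg α (fun n => d (n + 2)) 0 = Sg α d 2 := Sg_congr fun n => rfl
      have t2 : Sg α (fun n => c (n + 2)) 0 = Sg α c 2 := Sg_congr fun n => rfl
      unfold Dl at s2 ⊢
      rw [t1, t2]; linear_combination -s2
    have t1 : Sg α (fun n => d (n + 2)) 0 = Sg α d 2 := Sg_congr fun n => rfl
    refine ⟨c 1, α ^ 2 * Sg α d 2, bc1.1, bc1.2, by omega, ⟨_, _, np, by rw [t1]⟩, ?_, ?_⟩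
    · by_cases hk : c 1 = 0
      · exact Or.inl hk
      right
      by_cases h3 : c 3 = a - 1
      · have w1 := hp.hc.2 1
        simp only [Nat.reduceAdd] at w1
        unfold WordLt at w1
        have bc4 := hp.hc.1 4
        have bd4 := hp.hd.1 4
        rcases dF h hp.hd.1 hp.hc.1 s3 with ⟨e3, s4⟩ | ⟨e3, s4⟩
        · have := dA h hp.hc.1 hp.hd.1 (k := 4) (by rw [Dl_swap, s4, neg_neg])
          omega
        · simp only [Nat.reduceAdd] at s4
          rcases dG h hp.hd.1 hp.hc.1 s4 with ⟨e4, s5⟩ | ⟨e4, s5⟩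
          · omega
          · have v := dL_val h hp.hd.1 hp.hc.1 s5
            have ed2 := Sg_succ h hp.hd.1.abs 2
            have ed3 := Sg_succ h hp.hd.1.abs 3
            have ed4 := Sg_succ h hp.hd.1.abs 4
            have d3 : d 3 = a - 2 := by omega
            have d4 : d 4 = 0 := by omega
            rw [d2] at ed2; rw [d3] at ed3; rw [d4] at ed4
            simp only [Nat.reduceAdd, zero_add] at ed2 ed3 ed4 v
            push_cast at ed2 ed3 ed4
            have : α ^ 2 * Sg α d 2 = -1 - α ^ 3 := by
              linear_combination α ^ 2 * (ed2 + α * ed3 + α ^ 2 * ed4) + α ^ 4 * v - (α + 1) * h.root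
            rw [this]; exact pp_mem h
      · exact ⟨_, _, np, h3, by rw [t1]⟩
    · unfold Dl stA at s2
      unfold ev
      linear_combination α ^ 2 * (ec0 + α * ec1) - α ^ 4 * s2 + (α ^ 2 - 1) * h.root
  · right
    set c' : ℕ → ℤ := fun n => match n with
      | 0 => a - 1 | n + 1 => d (n + 4) with hc'
    set d' : ℕ → ℤ := fun n => match n with
      | 0 => 0 | n + 1 => c (n + 4) with hd'
    have bc : Bd a c' := by
      rintro (_ | n) <;> simp only [hc']
      · omega
      · exact hp.hd.1 _
    have bd : Bd a d' := by
      rintro (_ | n) <;> simp only [hd']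
      · omega
      · exact hp.hc.1 _
    have ac : Adm a c' := by
      refine ⟨bc, ?_⟩
      rintro (_ | n)
      · have w3 := hp.hd.2 3
        change WordLt a (d 6) (d 5) (d 4) (d 3) at w3
        change WordLt a (d 6) (d 5) (d 4) (a - 1)
        unfold WordLt at *
        have := hp.hd.1 4
        omega
      · exact hp.hd.2 (n + 4)
    have ad : Adm a d' := by
      refine ⟨bd, ?_⟩
      rintro (_ | n)
      · have w3 := hp.hc.2 3
        change WordLt a (c 6) (c 5) (c 4) (c 3) at w3
        change WordLt a (c 6) (c 5) (c 4) 0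
        rwa [c3] at w3
      · exact hp.hc.2 (n + 4)
    have tc : Sg α c' 1 = Sg α d 4 := Sg_congr fun n => rfl
    have td : Sg α d' 1 = Sg α c 4 := Sg_congr fun n => rfl
    have ec0' := Sg_succ h bc.abs 0
    have ed0' := Sg_succ h bd.abs 0
    have c0' : c' 0 = a - 1 := rfl
    have d0' : d' 0 = 0 := rfl
    rw [c0'] at ec0'; rw [d0'] at ed0'
    simp only [zero_add] at ec0' ed0'
    push_cast at ec0' ed0'
    rw [c2] at ec2; rw [c3] at ec3
    push_cast at ec2 ec3
    unfold Dl stF at s4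
    have np : Pair a α c' d' := by
      refine ⟨ac, ad, ?_⟩
      unfold Dl stA
      linear_combination ed0' - ec0' + α * (td - tc) + α * s4 - h.root
    refine ⟨c 1, α ^ 2 * Sg α c' 0, bc1.1, by omega, by omega, ⟨_, _, np, rfl⟩, ?_⟩
    unfold od
    linear_combination α ^ 2 * (ec0 + α * ec1 + α ^ 2 * ec2 + α ^ 3 * ec3) - α ^ 5 * ec0' - α ^ 6 * tc + α ^ 6 * s4 + (-α ^ 5 + α ^ 3 - α - 1) * h.root
  · left
    have v := dL_val h hp.hc.1 hp.hd.1 s3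
    rw [c2] at ec2; push_cast at ec2
    refine ⟨c 1, α - 1 - α ^ 2, bc1.1, bc1.2, by omega, WW'_sub (qq_mem h), Or.inr (qq_mem h), ?_⟩
    unfold ev
    linear_combination α ^ 2 * (ec0 + α * ec1 + α ^ 2 * ec2) + α ^ 4 * v - h.root

omit h in
lemma Dl_self0 {x y : ℕ → ℤ} (e : Sg α x 0 = Sg α y 0) : Dl α x y 0 = 0 := by
  unfold Dl; rw [e]; ring

/-- comparing two expansions of the same number -/
lemma lem3 {x y : ℕ → ℤ} (hx : Bd a x) (hy : Bd a y) (e : Sg α x 0 = Sg α y 0) (e0 : x 0 = y 0) :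
    (-1 ≤ x 1 - y 1 ∧ x 1 - y 1 ≤ 1) ∧ (x 1 = y 1 + 1 → x 2 = y 2 → Dl α y x 3 = stG a α) := by
  have hα := h.ne
  have D0 := Dl_succ h hy hx 0
  have D1 := Dl_succ h hy hx 1
  have D2 := Dl_succ h hy hx 2
  rw [Dl_self0 e.symm, e0] at D0
  simp only [Nat.reduceAdd, zero_add] at D0 D1 D2
  have z1 : Dl α y x 1 = 0 := by
    have : α * Dl α y x 1 = 0 := by linear_combination -D0
    exact (mul_eq_zero.1 this).resolve_left hα
  refine ⟨dO h hy hx z1, fun e1 e2 => ?_⟩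
  rw [e1] at D1; rw [e2] at D2
  push_cast at D1
  have : α ^ 2 * (Dl α y x 3 - stG a α) = 0 := by
    unfold stG
    linear_combination z1 - D1 - α * D2 + (α + 1) * h.root
  have := (mul_eq_zero.1 this).resolve_left (pow_ne_zero 2 hα)
  linear_combination this

lemma sum_d {c d c' d' : ℕ → ℤ} (hp : Pair a α c d) (hp' : Pair a α c' d')
    (e : Sg α c 0 = Sg α c' 0) : Sg α d 0 = Sg α d' 0 := by
  have h1 := hp.dl
  have h2 := hp'.dl
  unfold Dl at h1 h2
  linear_combination h1 - h2 + e

lemma sepEE_aux {c d c' d' : ℕ → ℤ} (hp : Pair a α c d) (hp' : Pair a α c' d')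
    (s' : Dl α c' d' 2 = -stA a α)
    (e : Sg α c 0 = Sg α c' 0) (e1 : c 1 = c' 1 + 1) : False := by
  have ha := h.ha
  have z := hp.zero h
  have z' := hp'.zero h
  have c2 := hp.c2 h
  have c2' := hp'.c2 h
  have s3 := (lem3 h hp.hc.1 hp'.hc.1 e (by omega)).2 e1 (by omega)
  have w1 := hp.hc.2 1
  simp only [Nat.reduceAdd] at w1
  unfold WordLt at w1
  have b1' := hp'.hc.1 1
  have b3 := hp.hc.1 3
  have b3' := hp'.hc.1 3
  have b4 := hp.hc.1 4
  have b4' := hp'.hc.1 4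
  have bd3' := hp'.hd.1 3
  have key : c' 3 = 0 → c' 4 = a - 1 := by
    intro h0
    obtain ⟨-, -, t3⟩ := hp'.even h s'
    rcases dF h hp'.hd.1 hp'.hc.1 t3 with ⟨e3, s4⟩ | ⟨e3, s4⟩
    · exact (dA h hp'.hc.1 hp'.hd.1 (k := 4) (by rw [Dl_swap, s4, neg_neg])).1
    · omega
  rcases dG h hp'.hc.1 hp.hc.1 s3 with ⟨e3, s4⟩ | ⟨e3, s4⟩
  · simp only [Nat.reduceAdd] at s4
    have := key (by omega)
    rcases dK h hp'.hc.1 hp.hc.1 s4 with e4 | ⟨e4, -⟩ <;> omega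
  · simp only [Nat.reduceAdd] at s4
    have := dL h hp'.hc.1 hp.hc.1 s4
    by_cases h0 : c' 3 = 0
    · have := key h0; omega
    · omega

lemma sepEE {κ κ' : ℤ} (k0 : 0 ≤ κ) (k1 : κ ≤ a - 1) (k0' : 0 ≤ κ') (k1' : κ' ≤ a - 1) {w w' : ℂ}
    (hw : w ∈ WW a α) (hk : κ = 0 ∨ w ∈ WW' a α) (hw' : w' ∈ WW a α) (hk' : κ' = 0 ∨ w' ∈ WW' a α)
    (e : ev α κ w = ev α κ' w') : κ = κ' := by
  obtain ⟨c, d, hp, c1, d1, s2, v⟩ := ev_mem h k0 k1 hw hk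
  obtain ⟨c', d', hp', c1', d1', s2', v'⟩ := ev_mem h k0' k1' hw' hk'
  have es : Sg α c 0 = Sg α c' 0 :=
    mul_left_cancel₀ (pow_ne_zero 2 h.ne) (by rw [v, v', e])
  have := (lem3 h hp.hc.1 hp'.hc.1 es (by rw [(hp.zero h).1, (hp'.zero h).1])).1
  rcases lt_trichotomy κ κ' with hlt | heq | hlt
  · exact (sepEE_aux h hp' hp s2 es.symm (by omega)).elim
  · exact heq
  · exact (sepEE_aux h hp hp' s2' es (by omega)).elim

lemma sepOO {κ κ' : ℤ} (k0 : 0 ≤ κ) (k1 : κ ≤ a - 2) (k0' : 0 ≤ κ') (k1' : κ' ≤ a - 2) {w w' : ℂ}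
    (hw : w ∈ WW a α) (hw' : w' ∈ WW a α) (e : od a α κ w = od a α κ' w') : κ = κ' := by
  have ha := h.ha
  obtain ⟨c, d, hp, c1, d1, c2, d2, c3, d3, s4, v⟩ := od_mem h k0 k1 hw
  obtain ⟨c', d', hp', c1', d1', c2', d2', c3', d3', s4', v'⟩ := od_mem h k0' k1' hw'
  have es : Sg α c 0 = Sg α c' 0 :=
    mul_left_cancel₀ (pow_ne_zero 2 h.ne) (by rw [v, v', e])
  have z : c 0 = c' 0 := by rw [(hp.zero h).1, (hp'.zero h).1]
  have L := lem3 h hp.hc.1 hp'.hc.1 es z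
  have L' := lem3 h hp'.hc.1 hp.hc.1 es.symm z.symm
  rcases lt_trichotomy κ κ' with hlt | heq | hlt
  · rcases dG h hp.hc.1 hp'.hc.1 (L'.2 (by omega) (by omega)) with ⟨e3, -⟩ | ⟨e3, -⟩ <;> omega
  · exact heq
  · rcases dG h hp'.hc.1 hp.hc.1 (L.2 (by omega) (by omega)) with ⟨e3, -⟩ | ⟨e3, -⟩ <;> omega

lemma sepEO {κ κ' : ℤ} (k0 : 0 ≤ κ) (k1 : κ ≤ a - 1) (k0' : 0 ≤ κ') (k1' : κ' ≤ a - 2) {w w' : ℂ}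
    (hw : w ∈ WW a α) (hk : κ = 0 ∨ w ∈ WW' a α) (hw' : w' ∈ WW a α)
    (e : ev α κ w = od a α κ' w') :
    (κ = κ' + 1 ∧ od a α κ' w' = od a α κ' (α - 1 - α ^ 2)) ∨
    (κ = κ' ∧ ev α κ w = ev α κ (α - 1 - α ^ 2)) := by
  have ha := h.ha
  obtain ⟨c, d, hp, c1, d1, s2, v⟩ := ev_mem h k0 k1 hw hk
  obtain ⟨c', d', hp', c1', d1', c2', d2', c3', d3', s4', v'⟩ := od_mem h k0' k1' hw'
  have es : Sg α c 0 = Sg α c' 0 :=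
    mul_left_cancel₀ (pow_ne_zero 2 h.ne) (by rw [v, v', e])
  have es' := sum_d h hp hp' es
  have z := hp.zero h
  have z' := hp'.zero h
  have L := lem3 h hp.hc.1 hp'.hc.1 es (by omega)
  have L' := lem3 h hp'.hd.1 hp.hd.1 es'.symm (by omega)
  obtain ⟨c2, d2, s3⟩ := hp.even h s2
  have hcase : κ = κ' + 1 ∨ κ = κ' := by omega
  rcases hcase with hκ | hκ
  · left
    refine ⟨hκ, ?_⟩
    have t3 := L.2 (by omega) (by omega)
    have w1 := hp.hc.2 1
    simp only [Nat.reduceAdd] at w1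
    unfold WordLt at w1
    have b4 := hp.hc.1 4
    have b4' := hp'.hc.1 4
    have bd4 := hp.hd.1 4
    rcases dG h hp'.hc.1 hp.hc.1 t3 with ⟨e3, t4⟩ | ⟨e3, t4⟩
    · simp only [Nat.reduceAdd] at t4
      have c4 : c 4 = a - 2 := by
        rcases dK h hp'.hc.1 hp.hc.1 t4 with e4 | ⟨e4, -⟩ <;> omega
      rcases dF h hp.hd.1 hp.hc.1 s3 with ⟨f3, s4⟩ | ⟨f3, s4⟩
      · have := dA h hp.hc.1 hp.hd.1 (k := 4) (by rw [Dl_swap, s4, neg_neg])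
        omega
      · simp only [Nat.reduceAdd] at s4
        rcases dG h hp.hd.1 hp.hc.1 s4 with ⟨e4, s5⟩ | ⟨e4, s5⟩
        · omega
        · have vv := dL_val' h hp.hd.1 hp.hc.1 s5
          have ec0 := Sg_succ h hp.hc.1.abs 0
          have ec1 := Sg_succ h hp.hc.1.abs 1
          have ec2 := Sg_succ h hp.hc.1.abs 2
          have ec3 := Sg_succ h hp.hc.1.abs 3
          have ec4 := Sg_succ h hp.hc.1.abs 4
          have c3 : c 3 = a - 1 := by omega
          rw [z.1] at ec0; rw [c1, hκ] at ec1; rw [c2] at ec2; rw [c3] at ec3; rw [c4] at ec4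
          simp only [Nat.reduceAdd, zero_add] at ec0 ec1 ec2 ec3 ec4 vv
          push_cast at ec0 ec1 ec2 ec3 ec4
          rw [← e, ← v]
          unfold od
          unfold stL at vv
          linear_combination α ^ 2 * (ec0 + α * ec1 + α ^ 2 * ec2 + α ^ 3 * ec3 + α ^ 4 * ec4) + α ^ 6 * vv + (α ^ 3 * (α ^ 3 - α ^ 2 - α - 1) - (α + 1)) * h.root
    · simp only [Nat.reduceAdd] at t4
      have vv := dL_val h hp'.hc.1 hp.hc.1 t4
      have ec0 := Sg_succ h hp'.hc.1.abs 0
      have ec1 := Sg_succ h hp'.hc.1.abs 1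
      have ec2 := Sg_succ h hp'.hc.1.abs 2
      have ec3 := Sg_succ h hp'.hc.1.abs 3
      rw [z'.1] at ec0; rw [c1'] at ec1; rw [c2'] at ec2; rw [c3'] at ec3
      simp only [Nat.reduceAdd, zero_add] at ec0 ec1 ec2 ec3 vv
      push_cast at ec0 ec1 ec2 ec3
      rw [← v']
      unfold od
      linear_combination α ^ 2 * (ec0 + α * ec1 + α ^ 2 * ec2 + α ^ 3 * ec3) + α ^ 5 * vv - (α + 1) * h.root
  · right
    refine ⟨hκ, ?_⟩
    have t3 := L'.2 (by omega) (by omega)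
    have b3 := hp.hd.1 3
    rcases dG h hp.hd.1 hp'.hd.1 t3 with ⟨e3, t4⟩ | ⟨e3, t4⟩
    · omega
    · have d3 : d 3 = 0 := by omega
      simp only [Nat.reduceAdd] at t4
      have vv := dL_val h hp.hd.1 hp'.hd.1 t4
      have ed0 := Sg_succ h hp.hd.1.abs 0
      have ed1 := Sg_succ h hp.hd.1.abs 1
      have ed2 := Sg_succ h hp.hd.1.abs 2
      have ed3 := Sg_succ h hp.hd.1.abs 3
      rw [z.2.1] at ed0; rw [d1] at ed1; rw [d2] at ed2; rw [d3] at ed3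
      simp only [Nat.reduceAdd, zero_add] at ed0 ed1 ed2 ed3 vv
      push_cast at ed0 ed1 ed2 ed3
      rw [← v]
      have hd := (dl_iff h c d).2 hp.dl
      unfold ev
      linear_combination hd + α ^ 2 * (ed0 + α * ed1 + α ^ 2 * ed2 + α ^ 3 * ed3) + α ^ 5 * vv - (α ^ 2) * h.root

end maps

/-- translation parts of the pieces -/
def bb (a : ℤ) (α : ℂ) (j : ℕ) : ℂ :=
  if j % 2 = 0 then α - 1 + ((a - 1 - (j / 2 : ℕ) : ℤ) : ℂ) * α ^ 3
  else -1 - (a - 2 - ((a - 2 - (j / 2 : ℕ) : ℤ) : ℂ)) * α ^ 3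

/-- linear parts of the pieces -/
def rr (α : ℂ) (j : ℕ) : ℂ := if j % 2 = 0 then α ^ 2 else α ^ 3

/-- which pieces are full copies -/
def ff (N : ℕ) (j : ℕ) : Bool := decide (j % 2 = 1 ∨ j + 1 = N)

lemma piece_even (a : ℤ) (α : ℂ) (k : ℕ) (w : ℂ) :
    bb a α (2 * k) + rr α (2 * k) * w = ev α (a - 1 - k) w := by
  have h1 : 2 * k % 2 = 0 := by omega
  have h2 : 2 * k / 2 = k := by omega
  simp only [bb, rr, h1, h2, if_true, ev]

lemma piece_odd (a : ℤ) (α : ℂ) (k : ℕ) (w : ℂ) :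
    bb a α (2 * k + 1) + rr α (2 * k + 1) * w = od a α (a - 2 - k) w := by
  have h1 : ¬ (2 * k + 1) % 2 = 0 := by omega
  have h2 : (2 * k + 1) / 2 = k := by omega
  simp only [bb, rr, h1, h2, if_false, od]

lemma ff_odd (N k : ℕ) : ff N (2 * k + 1) = true := by
  simp only [ff, decide_eq_true_eq]; omega

lemma ff_even (N k : ℕ) : ff N (2 * k) = true ↔ 2 * k + 1 = N := by
  simp only [ff, decide_eq_true_eq]; omega

lemma mem_even {a : ℤ} {α : ℂ} {N k : ℕ} (hN : (N : ℤ) = 2 * a - 1) {w : ℂ}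
    (hw : w ∈ if ff N (2 * k) = true then WW a α else WW' a α) :
    w ∈ WW a α ∧ (a - 1 - (k : ℤ) = 0 ∨ w ∈ WW' a α) := by
  split_ifs at hw with hf
  · rw [ff_even] at hf
    exact ⟨hw, Or.inl (by omega)⟩
  · exact ⟨WW'_sub hw, Or.inr hw⟩

lemma mem_even' {a : ℤ} {α : ℂ} {N k : ℕ} (hN : (N : ℤ) = 2 * a - 1) {w : ℂ}
    (hw : w ∈ WW a α) (hk : a - 1 - (k : ℤ) = 0 ∨ w ∈ WW' a α) :
    w ∈ if ff N (2 * k) = true then WW a α else WW' a α := by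
  split_ifs with hf
  · exact hw
  · rw [ff_even] at hf
    rcases hk with hk | hk
    · omega
    · exact hk

lemma mem_odd {a : ℤ} {α : ℂ} {N k : ℕ} {w : ℂ} :
    (w ∈ if ff N (2 * k + 1) = true then WW a α else WW' a α) ↔ w ∈ WW a α := by
  rw [if_pos (ff_odd N k)]

lemma main_arc {a : ℤ} {α : ℂ} {q : ℝ} (h : Par a α q) :
    ∃ f : ℝ → ℂ, ContinuousOn f (Set.Icc 0 1) ∧ Set.BijOn f (Set.Icc 0 1) (WW a α) ∧
      f 0 = -1 ∧ f 1 = α - 1 - α ^ 2 := by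
  have ha := h.ha
  obtain ⟨N, hN⟩ : ∃ N : ℕ, (N : ℤ) = 2 * a - 1 := ⟨(2 * a - 1).toNat, by omega⟩
  have hN5 : 5 ≤ N := by omega
  have hq : q < 1 / 2 := by have := h.q1; linarith
  have hr : ∀ j, ‖rr α j‖ ≤ q := by
    intro j
    unfold rr
    split_ifs
    · rw [norm_pow, h.nrm]
    · rw [norm_pow, pow_succ, h.nrm]
      have := h.nlt; have := h.q0; nlinarith
  have hr0 : ∀ j, rr α j ≠ 0 := by
    intro j; unfold rr; split_ifs <;> exact pow_ne_zero _ h.ne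
  obtain ⟨K, hK⟩ : ∃ K : ℕ, (K : ℤ) = a - 1 := ⟨(a - 1).toNat, by omega⟩
  have hNK : N - 1 = 2 * K := by omega
  have hfull : ff N (N - 1) = true := by rw [hNK, ff_even]; omega
  have e0 : bb a α 0 + rr α 0 * (α - 1 - α ^ 2) = -1 := by
    have := piece_even a α 0 (α - 1 - α ^ 2)
    rw [mul_zero] at this
    rw [this]; unfold ev; push_cast
    linear_combination -α * h.root
  have eN : bb a α (N - 1) + rr α (N - 1) * (-1) = α - 1 - α ^ 2 := by
    rw [hNK, piece_even, hK]; unfold ev; push_cast; ring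
  have e2 : bb a α 2 + rr α 2 * (α - 1 - α ^ 2) = -1 - α ^ 3 := by
    have := piece_even a α 1 (α - 1 - α ^ 2)
    rw [mul_one] at this
    rw [this]; unfold ev; push_cast
    linear_combination -α * h.root
  have hJ : ∀ j, j + 1 < N → bb a α (j + 1) + rr α (j + 1) * (α - 1 - α ^ 2) =
      bb a α j + rr α j * (if ff N j = true then -1 else -1 - α ^ 3) := by
    intro j hj
    obtain ⟨k, rfl | rfl⟩ := Nat.even_or_odd' j
    · rw [if_neg (by rw [ff_even]; omega), piece_odd, piece_even]
      unfold ev od; push_cast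
      linear_combination α * h.root
    · rw [if_pos (ff_odd N k), piece_odd, show 2 * k + 1 + 1 = 2 * (k + 1) by ring, piece_even]
      unfold ev od; push_cast
      linear_combination -α * h.root
  have hC : ∀ j < N, ∀ w ∈ (if ff N j = true then WW a α else WW' a α),
      bb a α j + rr α j * w ∈ WW a α := by
    intro j hj w hw
    obtain ⟨k, rfl | rfl⟩ := Nat.even_or_odd' j
    · rw [piece_even]
      obtain ⟨c, d, hp, -, -, -, v⟩ := ev_mem h (κ := a - 1 - k) (by omega) (by omega)
        (mem_even hN hw).1 (mem_even hN hw).2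
      exact ⟨c, d, hp, v.symm⟩
    · rw [piece_odd]
      obtain ⟨c, d, hp, -, -, -, -, -, -, -, v⟩ := od_mem h (κ := a - 2 - k) (by omega) (by omega)
        (mem_odd.1 hw)
      exact ⟨c, d, hp, v.symm⟩
  have hC' : ∀ j < N, 2 ≤ j → ∀ w ∈ (if ff N j = true then WW a α else WW' a α),
      bb a α j + rr α j * w ∈ WW' a α := by
    intro j hj hj2 w hw
    obtain ⟨k, rfl | rfl⟩ := Nat.even_or_odd' j
    · rw [piece_even]
      obtain ⟨c, d, hp, -, d1, -, v⟩ := ev_mem h (κ := a - 1 - k) (by omega) (by omega)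
        (mem_even hN hw).1 (mem_even hN hw).2
      exact ⟨c, d, hp, by omega, v.symm⟩
    · rw [piece_odd]
      obtain ⟨c, d, hp, -, d1, -, -, -, -, -, v⟩ := od_mem h (κ := a - 2 - k) (by omega) (by omega)
        (mem_odd.1 hw)
      exact ⟨c, d, hp, by omega, v.symm⟩
  have hEE : ∀ c d, Pair a α c d → ∃ j < N, (d 1 ≠ a - 1 → 2 ≤ j) ∧
      ∃ w ∈ (if ff N j = true then WW a α else WW' a α),
        α ^ 2 * Sg α c 0 = bb a α j + rr α j * w := by
    intro c d hp
    rcases exhaust h hp with ⟨κ, w, k0, k1, hd, hw, hk, v⟩ | ⟨κ, w, k0, k1, hd, hw, v⟩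
    · obtain ⟨k, hk'⟩ : ∃ k : ℕ, (k : ℤ) = a - 1 - κ := ⟨(a - 1 - κ).toNat, by omega⟩
      obtain rfl : κ = a - 1 - k := by omega
      refine ⟨2 * k, by omega, fun h1 => ?_, w, mem_even' hN hw hk, by rw [piece_even, v]⟩
      have := hd h1; omega
    · obtain ⟨k, hk'⟩ : ∃ k : ℕ, (k : ℤ) = a - 2 - κ := ⟨(a - 2 - κ).toNat, by omega⟩
      obtain rfl : κ = a - 2 - k := by omega
      refine ⟨2 * k + 1, by omega, fun h1 => ?_, w, mem_odd.2 hw, by rw [piece_odd, v]⟩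
      have := hd h1; omega
  have hE : ∀ z ∈ WW a α, ∃ j < N, ∃ w ∈ (if ff N j = true then WW a α else WW' a α),
      z = bb a α j + rr α j * w := by
    rintro z ⟨c, d, hp, rfl⟩
    obtain ⟨j, hj, -, hw⟩ := hEE c d hp
    exact ⟨j, hj, hw⟩
  have hE' : ∀ z ∈ WW' a α, ∃ j < N, 2 ≤ j ∧ ∃ w ∈ (if ff N j = true then WW a α else WW' a α),
      z = bb a α j + rr α j * w := by
    rintro z ⟨c, d, hp, h1, rfl⟩
    obtain ⟨j, hj, hj2, hw⟩ := hEE c d hp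
    exact ⟨j, hj, hj2 h1, hw⟩
  have hS : ∀ i j, i < j → j < N → ∀ w ∈ (if ff N i = true then WW a α else WW' a α),
      ∀ w' ∈ (if ff N j = true then WW a α else WW' a α),
      bb a α i + rr α i * w = bb a α j + rr α j * w' →
        j = i + 1 ∧ bb a α j + rr α j * w' = bb a α j + rr α j * (α - 1 - α ^ 2) := by
    intro i j hij hj w hw w' hw' e
    obtain ⟨k, rfl | rfl⟩ := Nat.even_or_odd' i
    · obtain ⟨l, rfl | rfl⟩ := Nat.even_or_odd' j
      · rw [piece_even, piece_even] at e
        have := sepEE h (by omega) (by omega) (by omega) (by omega) (mem_even hN hw).1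
          (mem_even hN hw).2 (mem_even hN hw').1 (mem_even hN hw').2 e
        omega
      · rw [piece_even, piece_odd] at e
        rw [piece_odd, piece_odd]
        rcases sepEO h (by omega) (by omega) (by omega) (by omega) (mem_even hN hw).1
          (mem_even hN hw).2 (mem_odd.1 hw') e with ⟨e1, e2⟩ | ⟨e1, e2⟩
        · exact ⟨by omega, e2⟩
        · omega
    · obtain ⟨l, rfl | rfl⟩ := Nat.even_or_odd' j
      · rw [piece_odd, piece_even] at e
        rw [piece_even, piece_even]
        rcases sepEO h (by omega) (by omega) (by omega) (by omega) (mem_even hN hw').1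
          (mem_even hN hw').2 (mem_odd.1 hw) e.symm with ⟨e1, e2⟩ | ⟨e1, e2⟩
        · omega
        · exact ⟨by omega, e2⟩
      · rw [piece_odd, piece_odd] at e
        have := sepOO h (by omega) (by omega) (by omega) (by omega) (mem_odd.1 hw)
          (mem_odd.1 hw') e
        omega
  have hinto := arc_into hN5 hq hr hfull e0 eN e2 hJ (WW_compact h).isClosed (WW'_compact h).isClosed
    ⟨_, qq_mem h⟩ WW'_sub hC hC'
  have hends := arc_ends hN5 hq hr hfull e0 eN
  refine ⟨arcFun N (ff N) (bb a α) (rr α), arc_cont hN5 hq hr hfull e0 eN e2 hJ,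
    ⟨fun t ht => hinto.1 t ht.1 ht.2, ?_, ?_⟩, hends.1, hends.2⟩
  · exact arc_inj hN5 hq hr hfull e0 eN e2 hJ hr0 hinto.1 hinto.2 hS
  · exact fun z hz => arc_surj hN5 hq hr hfull e0 eN e2 hJ (WW_compact h).isBounded WW'_sub hE hE' z hz

theorem bset_homeomorph_interval (a : ℤ) (ha : 3 ≤ a) (α : ℂ)
    (hroot : α ^ 3 - (a : ℂ) * α ^ 2 + α - 1 = 0) (hα : α.im ≠ 0) :
    (∃ f : ℝ → ℂ, ContinuousOn f (Set.Icc 0 1) ∧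
      Set.BijOn f (Set.Icc 0 1) (BSet a α (α - 1)) ∧
      f 0 = -1 ∧ f 1 = -(((a : ℂ) - 1) * α) - α⁻¹) ∧
    Nonempty ((Set.Icc (0 : ℝ) 1) ≃ₜ (BSet a α (α - 1))) := by
  have h := par_of a ha α hroot hα
  obtain ⟨f, hc, hb, f0, f1⟩ := main_arc h
  rw [bset_eq h]
  refine ⟨⟨f, hc, hb, f0, ?_⟩, ?_⟩
  · rw [f1]
    have hne := h.ne
    field_simp
    linear_combination -hroot
  · have hcont : Continuous (Set.BijOn.equiv f hb) := by
      rw [continuous_induced_rng]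
      exact continuousOn_iff_continuous_domRestrict.1 hc
    exact ⟨Continuous.homeoOfEquivCompactToT2 hcont⟩
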